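/- Let τ and τ' be points of the Siegel upper half-space H_3 such that θ_m(τ) ≠ 0 and θ_m(τ') ≠ 0 for every even characteristic m ∈ {0,1}³ × {0,1}³, and suppose that for every odd characteristic n ∈ {0,1}³ × {0,1}³ there exists λ_n ∈ ℂ, λ_n ≠ 0, with grad_z θ_n(τ', z)|_{z=0} = λ_n · grad_z θ_n(τ, z)|_{z=0}. Then for all even characteristics m_1, m_2 ∈ {0,1}³ × {0,1}³ one has θ_{m_1}(τ)⁴ · θ_{m_2}(τ')⁴ = θ_{m_1}(τ')⁴ · θ_{m_2}(τ)⁴. -/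

import Mathlib

open scoped BigOperators
open Complex Matrix

noncomputable section

/-- The Siegel upper half-space: complex symmetric `g × g` matrices with
positive definite imaginary part. -/
def IsSiegel {g : ℕ} (τ : Matrix (Fin g) (Fin g) ℂ) : Prop :=
  τ.IsSymm ∧ Matrix.PosDef (Matrix.of fun i j => (τ i j).im)

/-- The `p`-th term of the Riemann theta series with characteristic `m`. -/
def thetaTerm {g : ℕ} (m : (Fin g → ℤ) × (Fin g → ℤ))
    (τ : Matrix (Fin g) (Fin g) ℂ) (z : Fin g → ℂ) (p : Fin g → ℤ) : ℂ :=
  Complex.exp ((Real.pi : ℂ) * Complex.I *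
      (∑ i, ∑ j, ((p i : ℂ) + (m.1 i : ℂ) / 2) * τ i j * ((p j : ℂ) + (m.1 j : ℂ) / 2))
    + 2 * (Real.pi : ℂ) * Complex.I *
      (∑ i, ((p i : ℂ) + (m.1 i : ℂ) / 2) * (z i + (m.2 i : ℂ) / 2)))

/-- The Riemann theta function with characteristic `m`. -/
def theta {g : ℕ} (m : (Fin g → ℤ) × (Fin g → ℤ))
    (τ : Matrix (Fin g) (Fin g) ℂ) (z : Fin g → ℂ) : ℂ :=
  ∑' p : Fin g → ℤ, thetaTerm m τ z p

/-- The gradient `grad_z θ_m(τ, z)|_{z = 0}`. -/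
def thetaGrad {g : ℕ} (m : (Fin g → ℤ) × (Fin g → ℤ))
    (τ : Matrix (Fin g) (Fin g) ℂ) : Fin g → ℂ :=
  fun j => fderiv ℂ (fun z => theta m τ z) 0 (Pi.single j 1)

/-- The Jacobian determinant `D(n₁, …, n_g)(τ)`. -/
def jacDet {g : ℕ} (n : Fin g → (Fin g → ℤ) × (Fin g → ℤ))
    (τ : Matrix (Fin g) (Fin g) ℂ) : ℂ :=
  ((Real.pi : ℂ) ^ g)⁻¹ * Matrix.det (Matrix.of fun i j => thetaGrad (n i) τ j)

/-- A characteristic mod 2 in genus `g`. -/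
abbrev ThetaChar (g : ℕ) := (Fin g → ZMod 2) × (Fin g → ZMod 2)

/-- Lift of a mod-2 characteristic to the integer representative with entries in `{0,1}`. -/
def charLift {g : ℕ} (m : ThetaChar g) : (Fin g → ℤ) × (Fin g → ℤ) :=
  (fun i => ((m.1 i).val : ℤ), fun i => ((m.2 i).val : ℤ))

/-- `m'·m''` computed on the `{0,1}` representatives. -/
def charDot {g : ℕ} (m : ThetaChar g) : ℕ := ∑ i, (m.1 i).val * (m.2 i).val

/-- The parity `e(m) = (-1)^{m'·m''}` of a characteristic. -/
def charParity {g : ℕ} (m : ThetaChar g) : ℤ := (-1) ^ charDot m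

def IsOddChar {g : ℕ} (m : ThetaChar g) : Prop := charParity m = -1

def IsEvenChar {g : ℕ} (m : ThetaChar g) : Prop := charParity m = 1

/-- A tuple of characteristics is azygetic if
`e(nᵢ)e(nⱼ)e(nₖ)e(nᵢ+nⱼ+nₖ) = -1` for all `i < j < k`. -/
def Azygetic {g k : ℕ} (n : Fin k → ThetaChar g) : Prop :=
  ∀ i j l : Fin k, i < j → j < l →
    charParity (n i) * charParity (n j) * charParity (n l) *
      charParity (n i + n j + n l) = -1

/-- An Aronhold set in genus 3: seven pairwise distinct odd characteristics such
that, together with their sum, they form an azygetic 8-tuple. -/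
def IsAronhold (n : Fin 7 → ThetaChar 3) : Prop :=
  Function.Injective n ∧ (∀ i, IsOddChar (n i)) ∧
    Azygetic (Fin.snoc n (∑ i, n i) : Fin 8 → ThetaChar 3)

/-- The standard symplectic form matrix `J = (0 I; -I 0)` over a ring. -/
def Jmat (g : ℕ) (R : Type*) [Ring R] :
    Matrix (Fin g ⊕ Fin g) (Fin g ⊕ Fin g) R :=
  Matrix.fromBlocks 0 1 (-1) 0

/-- The blocks `(a b; c d)` form a symplectic matrix over `R`. -/
def IsSymplectic {g : ℕ} {R : Type*} [Ring R]
    (a b c d : Matrix (Fin g) (Fin g) R) : Prop :=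
  (Matrix.fromBlocks a b c d)ᵀ * Jmat g R * Matrix.fromBlocks a b c d = Jmat g R

/-- The action of `Sp(2g, ℤ)` on mod-2 characteristics. -/
def charAction {g : ℕ} (a b c d : Matrix (Fin g) (Fin g) ℤ) (m : ThetaChar g) : ThetaChar g :=
  (fun i => (∑ j, ((d i j : ZMod 2)) * m.1 j) - (∑ j, ((c i j : ZMod 2)) * m.2 j)
      + (((c * dᵀ) i i : ℤ) : ZMod 2),
   fun i => -(∑ j, ((b i j : ZMod 2)) * m.1 j) + (∑ j, ((a i j : ZMod 2)) * m.2 j)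
      + (((a * bᵀ) i i : ℤ) : ZMod 2))

/-- The Jacobian determinant in genus 3, for three mod-2 odd characteristics. -/
def D3 (n1 n2 n3 : ThetaChar 3) (τ : Matrix (Fin 3) (Fin 3) ℂ) : ℂ :=
  jacDet ![charLift n1, charLift n2, charLift n3] τ

end

noncomputable section

namespace ThetaLemmas

section Series

variable {g : ℕ}

/-- Coefficients decaying faster than every exponential. -/
def Rapid (a : (Fin g → ℤ) → ℂ) : Prop :=
  ∀ R : ℝ, Summable fun p => ‖a p‖ * Real.exp (R * ∑ i, |(p i : ℝ)|)

/-- The pairing of an integer vector with a complex vector. -/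
def pairing (p : Fin g → ℤ) (z : Fin g → ℂ) : ℂ := ∑ i, (p i : ℂ) * z i

/-- The Fourier series with coefficients `a`. -/
def fourierSum (a : (Fin g → ℤ) → ℂ) (z : Fin g → ℂ) : ℂ :=
  ∑' p, a p * cexp (2 * Real.pi * I * pairing p z)

theorem norm_pairing_le (p : Fin g → ℤ) (z : Fin g → ℂ) :
    ‖pairing p z‖ ≤ ‖z‖ * ∑ i, |(p i : ℝ)| := by
  unfold pairing
  refine (norm_sum_le _ _).trans ?_
  rw [Finset.mul_sum]
  refine Finset.sum_le_sum fun i _ => ?_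
  rw [norm_mul, mul_comm]
  have : ‖((p i : ℤ) : ℂ)‖ = |(p i : ℝ)| := by simp
  rw [this]
  exact mul_le_mul_of_nonneg_right (norm_le_pi_norm z i) (abs_nonneg _)

theorem norm_exp_pairing_le (p : Fin g → ℤ) (z : Fin g → ℂ) {M : ℝ} (hz : ‖z‖ ≤ M) :
    ‖cexp (2 * Real.pi * I * pairing p z)‖ ≤
      Real.exp ((2 * Real.pi * M) * ∑ i, |(p i : ℝ)|) := by
  refine (Complex.norm_exp_le_exp_norm _).trans (Real.exp_le_exp.mpr ?_)
  have h0 : (0 : ℝ) ≤ ∑ i, |(p i : ℝ)| := Finset.sum_nonneg fun i _ => abs_nonneg _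
  have h1 : ‖(2 * Real.pi * I * pairing p z : ℂ)‖ = 2 * Real.pi * ‖pairing p z‖ := by
    simp [abs_of_pos Real.pi_pos]
  rw [h1]
  have h2 := norm_pairing_le p z
  have h3 : ‖z‖ * ∑ i, |(p i : ℝ)| ≤ M * ∑ i, |(p i : ℝ)| :=
    mul_le_mul_of_nonneg_right hz h0
  have := Real.pi_pos
  nlinarith

theorem Rapid.mul_of_le {a c : (Fin g → ℤ) → ℂ} (ha : Rapid a) (C K : ℝ)
    (hc : ∀ p, ‖c p‖ ≤ C * Real.exp (K * ∑ i, |(p i : ℝ)|)) :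
    Rapid fun p => a p * c p := by
  intro R
  refine Summable.of_nonneg_of_le (fun p => by positivity) (fun p => ?_)
    ((ha (K + R)).mul_left C)
  rw [norm_mul, add_mul, Real.exp_add]
  have := mul_le_mul_of_nonneg_left (hc p) (norm_nonneg (a p))
  have := mul_le_mul_of_nonneg_right this (Real.exp_pos (R * ∑ i, |(p i : ℝ)|)).le
  refine this.trans (le_of_eq ?_)
  ring

theorem Rapid.mul_exp {a : (Fin g → ℤ) → ℂ} (ha : Rapid a) (w : Fin g → ℂ) :
    Rapid fun p => a p * cexp (2 * Real.pi * I * pairing p w) :=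
  ha.mul_of_le 1 (2 * Real.pi * ‖w‖) fun p => by
    rw [one_mul]; exact norm_exp_pairing_le p w le_rfl

theorem Rapid.mul_pairing {a : (Fin g → ℤ) → ℂ} (ha : Rapid a) (u : Fin g → ℂ) :
    Rapid fun p => a p * (2 * Real.pi * I * pairing p u) :=
  ha.mul_of_le (2 * Real.pi * ‖u‖) 1 fun p => by
    have h1 : ‖(2 * Real.pi * I * pairing p u : ℂ)‖ = 2 * Real.pi * ‖pairing p u‖ := by
      simp [abs_of_pos Real.pi_pos]
    rw [h1, one_mul, mul_assoc (2 * Real.pi)]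
    have := norm_pairing_le p u
    have h2 : ∑ i, |(p i : ℝ)| ≤ Real.exp (∑ i, |(p i : ℝ)|) := by
      linarith [Real.add_one_le_exp (∑ i, |(p i : ℝ)|)]
    have h3 := mul_le_mul_of_nonneg_left h2 (norm_nonneg u)
    have := Real.pi_pos
    gcongr
    linarith

theorem Rapid.mul_const {a : (Fin g → ℤ) → ℂ} (ha : Rapid a) (c : ℂ) :
    Rapid fun p => a p * c :=
  ha.mul_of_le ‖c‖ 0 fun p => by simp

theorem Rapid.summable_norm {a : (Fin g → ℤ) → ℂ} (ha : Rapid a) (z : Fin g → ℂ) :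
    Summable fun p => ‖a p * cexp (2 * Real.pi * I * pairing p z)‖ := by
  simpa using ha.mul_exp z 0

/-- The pairing with an integer vector as a continuous linear map. -/
def pairingCLM (p : Fin g → ℤ) : (Fin g → ℂ) →L[ℂ] ℂ :=
  ∑ i, (p i : ℂ) • ContinuousLinearMap.proj (R := ℂ) (φ := fun _ : Fin g => ℂ) i

theorem pairingCLM_apply (p : Fin g → ℤ) (z : Fin g → ℂ) : pairingCLM p z = pairing p z := by
  simp [pairingCLM, pairing]

theorem norm_pairingCLM_le (p : Fin g → ℤ) : ‖pairingCLM p‖ ≤ ∑ i, |(p i : ℝ)| := by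
  refine ContinuousLinearMap.opNorm_le_bound _ (Finset.sum_nonneg fun i _ => abs_nonneg _) ?_
  intro z
  rw [pairingCLM_apply, mul_comm]
  exact norm_pairing_le p z

theorem Rapid.hasFDerivAt {a : (Fin g → ℤ) → ℂ} (ha : Rapid a) (z : Fin g → ℂ) :
    HasFDerivAt (fourierSum a)
      (∑' p, (a p * cexp (2 * Real.pi * I * pairing p z) * (2 * Real.pi * I)) • pairingCLM p) z := by
  set M : ℝ := ‖z‖ + 1
  have hu : Summable fun p => (2 * Real.pi) *
      (‖a p‖ * Real.exp ((2 * Real.pi * M + 1) * ∑ i, |(p i : ℝ)|)) := (ha _).mul_left _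
  have hz : z ∈ Metric.ball (0 : Fin g → ℂ) M := by simp [M]
  refine hasFDerivAt_tsum_of_isPreconnected (s := Metric.ball (0 : Fin g → ℂ) M)
    (f := fun p (z : Fin g → ℂ) => a p * cexp (2 * Real.pi * I * pairing p z))
    (f' := fun p z =>
      (a p * cexp (2 * Real.pi * I * pairing p z) * (2 * Real.pi * I)) • pairingCLM p)
    hu Metric.isOpen_ball (convex_ball _ _).isPreconnected ?_ ?_ hz
    (ha.summable_norm z).of_norm hz
  · intro p x _
    have h1 : HasFDerivAt (fun z : Fin g → ℂ => pairing p z) (pairingCLM p) x := by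
      have := (pairingCLM p).hasFDerivAt (x := x)
      simpa only [← pairingCLM_apply] using this
    have h2 := ((h1.const_mul (2 * Real.pi * I : ℂ)).cexp).const_mul (a p)
    refine h2.congr_fderiv ?_
    ext v
    simp only [_root_.smul_apply, smul_eq_mul]
    ring
  · intro p x hx
    rw [norm_smul, norm_mul, norm_mul]
    have hx' : ‖x‖ ≤ M := by simpa using (Metric.mem_ball.mp hx).le
    have h1 := norm_exp_pairing_le p x hx'
    have h2 : ‖(2 * Real.pi * I : ℂ)‖ = 2 * Real.pi := by simp [abs_of_pos Real.pi_pos]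
    have h3 := norm_pairingCLM_le p
    have h4 : ∑ i, |(p i : ℝ)| ≤ Real.exp (∑ i, |(p i : ℝ)|) := by
      linarith [Real.add_one_le_exp (∑ i, |(p i : ℝ)|)]
    have := Real.pi_pos
    rw [h2, add_mul, one_mul, Real.exp_add]
    calc ‖a p‖ * ‖cexp (2 * Real.pi * I * pairing p x)‖ * (2 * Real.pi) * ‖pairingCLM p‖
        ≤ ‖a p‖ * Real.exp (2 * Real.pi * M * ∑ i, |(p i : ℝ)|) * (2 * Real.pi) *
          Real.exp (∑ i, |(p i : ℝ)|) := by gcongr; exact h3.trans h4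
      _ = _ := by ring

theorem Rapid.differentiable {a : (Fin g → ℤ) → ℂ} (ha : Rapid a) :
    Differentiable ℂ (fourierSum a) := fun z => (ha.hasFDerivAt z).differentiableAt

theorem Rapid.fderiv_apply {a : (Fin g → ℤ) → ℂ} (ha : Rapid a) (z u : Fin g → ℂ) :
    fderiv ℂ (fourierSum a) z u =
      fourierSum (fun p => a p * (2 * Real.pi * I * pairing p u)) z := by
  rw [(ha.hasFDerivAt z).fderiv]
  have hs : Summable fun p =>
      (a p * cexp (2 * Real.pi * I * pairing p z) * (2 * Real.pi * I)) • pairingCLM p := by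
    refine Summable.of_norm_bounded ((ha.mul_exp z |>.mul_const (2 * Real.pi * I)) 1) fun p => ?_
    rw [norm_smul, one_mul]
    gcongr
    exact (norm_pairingCLM_le p).trans (by linarith [Real.add_one_le_exp (∑ i, |(p i : ℝ)|)])
  rw [← ContinuousLinearMap.apply_apply u, ContinuousLinearMap.map_tsum _ hs]
  unfold fourierSum
  refine tsum_congr fun p => ?_
  simp only [ContinuousLinearMap.apply_apply, _root_.smul_apply, smul_eq_mul,
    pairingCLM_apply]
  ring

theorem fourierSum_add_int (a : (Fin g → ℤ) → ℂ) (z : Fin g → ℂ) (k : Fin g → ℤ) :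
    fourierSum a (fun i => z i + k i) = fourierSum a z := by
  unfold fourierSum
  refine tsum_congr fun p => ?_
  congr 1
  rw [Complex.exp_eq_exp_iff_exists_int]
  refine ⟨∑ i, p i * k i, ?_⟩
  simp only [pairing, mul_add, Finset.sum_add_distrib]
  push_cast
  ring

end Series

section Gauss

variable {g : ℕ}

theorem summable_prod_of_summable {f : ℤ → ℝ} (hf0 : ∀ n, 0 ≤ f n) (hf : Summable f) :
    Summable fun p : Fin g → ℤ => ∏ i, f (p i) := by
  classical
  refine summable_of_sum_le (c := ∏ _i : Fin g, ∑' n, f n)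
    (fun p => Finset.prod_nonneg fun i _ => hf0 _) fun S => ?_
  calc ∑ p ∈ S, ∏ i, f (p i)
      ≤ ∑ p ∈ Fintype.piFinset (fun i => S.image fun p => p i), ∏ i, f (p i) := by
        refine Finset.sum_le_sum_of_subset_of_nonneg (fun p hp => ?_)
          fun p _ _ => Finset.prod_nonneg fun i _ => hf0 _
        rw [Fintype.mem_piFinset]
        exact fun i => Finset.mem_image_of_mem _ hp
    _ = ∏ i : Fin g, ∑ n ∈ S.image (fun p => p i), f n := by
        rw [Finset.prod_univ_sum]
    _ ≤ _ := by
        refine Finset.prod_le_prod (fun i _ => Finset.sum_nonneg fun n _ => hf0 n) fun i _ => ?_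
        exact hf.sum_le_tsum _ fun n _ => hf0 n

theorem summable_exp_neg_abs : Summable fun n : ℤ => Real.exp (-|(n : ℝ)|) := by
  have h : Summable fun n : ℕ => Real.exp (-(n : ℝ)) := by
    simpa using Real.summable_exp_neg_nat
  refine Summable.of_nat_of_neg ?_ ?_ <;> simpa using h

theorem exists_pos_le_quadratic {Y : Matrix (Fin g) (Fin g) ℝ} (hY : Y.PosDef) :
    ∃ l : ℝ, 0 < l ∧ ∀ x : Fin g → ℝ, l * ∑ i, x i ^ 2 ≤ x ⬝ᵥ Y *ᵥ x := by
  have hpos : ∀ x : Fin g → ℝ, x ≠ 0 → 0 < x ⬝ᵥ Y *ᵥ x := fun x hx => by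
    simpa using hY.dotProduct_mulVec_pos hx
  have hcont : Continuous fun x : Fin g → ℝ => x ⬝ᵥ Y *ᵥ x := by fun_prop
  rcases (Metric.sphere (0 : Fin g → ℝ) 1).eq_empty_or_nonempty with he | hne
  · refine ⟨1, one_pos, fun x => ?_⟩
    have hx : x = 0 := by
      by_contra hx
      have : (‖x‖⁻¹ • x) ∈ Metric.sphere (0 : Fin g → ℝ) 1 := by
        simp [norm_smul, inv_mul_cancel₀ (norm_ne_zero_iff.mpr hx)]
      rw [he] at this
      exact this
    simp [hx]
  · obtain ⟨x₀, hx₀, hmin⟩ := (isCompact_sphere (0 : Fin g → ℝ) 1).exists_isMinOn hne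
      hcont.continuousOn
    have hx₀' : x₀ ≠ 0 := by
      rintro rfl
      simp at hx₀
    set m := x₀ ⬝ᵥ Y *ᵥ x₀ with hm
    have hm0 : 0 < m := hpos x₀ hx₀'
    refine ⟨m / (g + 1), by positivity, fun x => ?_⟩
    have hsup : m * ‖x‖ ^ 2 ≤ x ⬝ᵥ Y *ᵥ x := by
      by_cases hx : x = 0
      · simp [hx]
      have hn : 0 < ‖x‖ := norm_pos_iff.mpr hx
      have hmem : (‖x‖⁻¹ • x) ∈ Metric.sphere (0 : Fin g → ℝ) 1 := by
        simp [norm_smul, inv_mul_cancel₀ hn.ne']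
      have h := hmin hmem
      simp only [Set.mem_ofPred_eq, mulVec_smul, dotProduct_smul, smul_dotProduct,
        smul_eq_mul] at h
      rw [← hm] at h
      have h2 := mul_le_mul_of_nonneg_right h (sq_nonneg ‖x‖)
      refine h2.trans (le_of_eq ?_)
      field_simp
    have hsum : ∑ i, x i ^ 2 ≤ g * ‖x‖ ^ 2 := by
      calc ∑ i, x i ^ 2 ≤ ∑ _i : Fin g, ‖x‖ ^ 2 := by
            refine Finset.sum_le_sum fun i _ => ?_
            rw [← sq_abs]
            exact pow_le_pow_left₀ (abs_nonneg _) (norm_le_pi_norm x i) 2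
        _ = _ := by simp
    refine le_trans ?_ hsup
    rw [div_mul_eq_mul_div, div_le_iff₀ (by positivity)]
    have : 0 ≤ ‖x‖ ^ 2 := sq_nonneg _
    nlinarith

/-- The complex vector underlying an integer vector. -/
def ic (p : Fin g → ℤ) : Fin g → ℂ := fun i => (p i : ℂ)

theorem rapid_gauss {τ : Matrix (Fin g) (Fin g) ℂ} (hτ : IsSiegel τ) :
    Rapid fun p => cexp (Real.pi * I * (ic p ⬝ᵥ τ *ᵥ ic p)) := by
  obtain ⟨l, hl, hq⟩ := exists_pos_le_quadratic hτ.2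
  intro R
  have hpi := Real.pi_pos
  obtain ⟨C, hC'⟩ : ∃ C : ℝ, C * (4 * (Real.pi * l)) = (R + 1) ^ 2 :=
    ⟨(R + 1) ^ 2 / (4 * (Real.pi * l)), by field_simp⟩
  have hs : Summable fun p : Fin g → ℤ => ∏ i, (Real.exp C * Real.exp (-|(p i : ℝ)|)) :=
    summable_prod_of_summable (f := fun n : ℤ => Real.exp C * Real.exp (-|(n : ℝ)|))
      (fun n => by positivity) (summable_exp_neg_abs.mul_left _)
  refine Summable.of_nonneg_of_le (fun p => by positivity) (fun p => ?_) hs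
  have hprod : ∏ i, (Real.exp C * Real.exp (-|(p i : ℝ)|)) =
      Real.exp (∑ i, (C + -|(p i : ℝ)|)) := by
    rw [Real.exp_sum]
    exact Finset.prod_congr rfl fun i _ => (Real.exp_add _ _).symm
  rw [hprod, Complex.norm_exp, ← Real.exp_add, Real.exp_le_exp]
  have him : (Real.pi * I * (ic p ⬝ᵥ τ *ᵥ ic p)).re =
      -(Real.pi * ((fun i => (p i : ℝ)) ⬝ᵥ
        (Matrix.of fun i j => (τ i j).im) *ᵥ fun i => (p i : ℝ))) := by
    have h1 : (ic p ⬝ᵥ τ *ᵥ ic p).im = (fun i => (p i : ℝ)) ⬝ᵥ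
        (Matrix.of fun i j => (τ i j).im) *ᵥ fun i => (p i : ℝ) := by
      simp [dotProduct, mulVec, ic, Complex.im_sum, Complex.mul_im, Complex.mul_re]
    rw [← h1]
    simp [Complex.mul_re, Complex.mul_im]
  rw [him]
  have h := hq fun i => (p i : ℝ)
  have h2 : ∑ i, (R * |(p i : ℝ)| - Real.pi * l * (p i : ℝ) ^ 2) ≤
      ∑ i, (C + -|(p i : ℝ)|) := by
    refine Finset.sum_le_sum fun i _ => ?_
    have hk : 0 < Real.pi * l := by positivity
    rw [← sq_abs (p i : ℝ)]
    have := sq_nonneg (2 * (Real.pi * l) * |(p i : ℝ)| - (R + 1))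
    nlinarith
  refine le_trans ?_ h2
  rw [Finset.sum_sub_distrib, ← Finset.mul_sum, ← Finset.mul_sum]
  nlinarith

theorem isSiegel_two_smul {τ : Matrix (Fin g) (Fin g) ℂ} (hτ : IsSiegel τ) :
    IsSiegel ((2 : ℂ) • τ) := by
  refine ⟨hτ.1.smul 2, ?_⟩
  have : (Matrix.of fun i j => (((2 : ℂ) • τ) i j).im) =
      (2 : ℝ) • Matrix.of fun i j => (τ i j).im := by
    ext i j
    simp
  rw [this]
  exact hτ.2.smul two_pos

/-- The theta series with arbitrary complex characteristic `c`. -/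
def gtheta (τ : Matrix (Fin g) (Fin g) ℂ) (c z : Fin g → ℂ) : ℂ :=
  ∑' p : Fin g → ℤ, cexp (Real.pi * I * ((ic p + c) ⬝ᵥ τ *ᵥ (ic p + c)) +
    2 * Real.pi * I * ((ic p + c) ⬝ᵥ z))

/-- The Fourier coefficients of `gtheta`. -/
def gcoeff (τ : Matrix (Fin g) (Fin g) ℂ) (c : Fin g → ℂ) (p : Fin g → ℤ) : ℂ :=
  cexp (Real.pi * I * ((ic p + c) ⬝ᵥ τ *ᵥ (ic p + c)))

theorem dotProduct_mulVec_comm_of_isSymm {τ : Matrix (Fin g) (Fin g) ℂ} (hτ : τ.IsSymm)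
    (x y : Fin g → ℂ) : x ⬝ᵥ τ *ᵥ y = y ⬝ᵥ τ *ᵥ x := by
  rw [dotProduct_comm x, ← vecMul_transpose, hτ.eq, dotProduct_mulVec]

theorem rapid_gcoeff {τ : Matrix (Fin g) (Fin g) ℂ} (hτ : IsSiegel τ) (c : Fin g → ℂ) :
    Rapid (gcoeff τ c) := by
  have h := ((rapid_gauss hτ).mul_exp (τ *ᵥ c)).mul_const
    (cexp (Real.pi * I * (c ⬝ᵥ τ *ᵥ c)))
  convert h using 2 with p
  rw [gcoeff, ← Complex.exp_add, ← Complex.exp_add]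
  congr 1
  have : pairing p (τ *ᵥ c) = ic p ⬝ᵥ τ *ᵥ c := rfl
  rw [this, mulVec_add, dotProduct_add, add_dotProduct, add_dotProduct,
    dotProduct_mulVec_comm_of_isSymm hτ.1 c (ic p)]
  ring

theorem gtheta_eq (τ : Matrix (Fin g) (Fin g) ℂ) (c z : Fin g → ℂ) :
    gtheta τ c z = cexp (2 * Real.pi * I * (c ⬝ᵥ z)) * fourierSum (gcoeff τ c) z := by
  rw [gtheta, fourierSum, ← tsum_mul_left]
  refine tsum_congr fun p => ?_
  have : pairing p z = ic p ⬝ᵥ z := rfl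
  rw [gcoeff, ← Complex.exp_add, ← Complex.exp_add, this, add_dotProduct _ _ z]
  congr 1
  ring

theorem summable_norm_gtheta {τ : Matrix (Fin g) (Fin g) ℂ} (hτ : IsSiegel τ) (c z : Fin g → ℂ) :
    Summable fun p : Fin g → ℤ => ‖cexp (Real.pi * I * ((ic p + c) ⬝ᵥ τ *ᵥ (ic p + c)) +
      2 * Real.pi * I * ((ic p + c) ⬝ᵥ z))‖ := by
  refine (((rapid_gcoeff hτ c).summable_norm z).mul_left
    ‖cexp (2 * Real.pi * I * (c ⬝ᵥ z))‖).congr fun p => ?_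
  have : pairing p z = ic p ⬝ᵥ z := rfl
  rw [← norm_mul, gcoeff, ← Complex.exp_add, ← Complex.exp_add, this, add_dotProduct _ _ z]
  congr 2
  ring

theorem differentiable_gtheta {τ : Matrix (Fin g) (Fin g) ℂ} (hτ : IsSiegel τ) (c : Fin g → ℂ) :
    Differentiable ℂ (gtheta τ c) := by
  have h : gtheta τ c = fun z => cexp (2 * Real.pi * I * (c ⬝ᵥ z)) * fourierSum (gcoeff τ c) z :=
    funext (gtheta_eq τ c)
  rw [h]
  have h1 : Differentiable ℂ fun z : Fin g → ℂ => c ⬝ᵥ z := by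
    unfold dotProduct
    fun_prop
  exact ((h1.const_mul _).cexp).mul (rapid_gcoeff hτ c).differentiable

theorem differentiable_fderiv_gtheta {τ : Matrix (Fin g) (Fin g) ℂ} (hτ : IsSiegel τ)
    (c u : Fin g → ℂ) : Differentiable ℂ fun z => fderiv ℂ (gtheta τ c) z u := by
  have h : gtheta τ c = fun z => cexp (2 * Real.pi * I * (c ⬝ᵥ z)) * fourierSum (gcoeff τ c) z :=
    funext (gtheta_eq τ c)
  have h1 : Differentiable ℂ fun z : Fin g → ℂ => c ⬝ᵥ z := by
    unfold dotProduct
    fun_prop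
  have he := (h1.const_mul (2 * Real.pi * I)).cexp
  have hS := (rapid_gcoeff hτ c).differentiable
  set l : (Fin g → ℂ) →L[ℂ] ℂ := LinearMap.toContinuousLinearMap (dotProductBilin ℂ ℂ c)
  have hd : (fun z => fderiv ℂ (gtheta τ c) z u) = fun z =>
      cexp (2 * Real.pi * I * (c ⬝ᵥ z)) *
        fourierSum (fun p => gcoeff τ c p * (2 * Real.pi * I * pairing p u)) z +
      fourierSum (gcoeff τ c) z *
        (cexp (2 * Real.pi * I * (c ⬝ᵥ z)) * (2 * Real.pi * I * (c ⬝ᵥ u))) := by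
    funext z
    have hl : HasFDerivAt (fun z : Fin g → ℂ => c ⬝ᵥ z) l z := l.hasFDerivAt
    have hlu : l u = c ⬝ᵥ u := rfl
    rw [h, ((hl.const_mul (2 * Real.pi * I)).cexp.fun_mul (hS z).hasFDerivAt).fderiv]
    simp only [_root_.add_apply, _root_.smul_apply, smul_eq_mul,
      (rapid_gcoeff hτ c).fderiv_apply, hlu]
  rw [hd]
  have hS2 := ((rapid_gcoeff hτ c).mul_pairing u).differentiable
  fun_prop

theorem gtheta_add_int_char (τ : Matrix (Fin g) (Fin g) ℂ) (c z : Fin g → ℂ) (k : Fin g → ℤ) :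
    gtheta τ (c + ic k) z = gtheta τ c z := by
  rw [gtheta, gtheta]
  conv_rhs => rw [← (Equiv.addRight k).tsum_eq]
  refine tsum_congr fun p => ?_
  have : ic (Equiv.addRight k p) + c = ic p + (c + ic k) := by
    ext i
    simp [ic]
    ring
  rw [this]

theorem gtheta_add_int (τ : Matrix (Fin g) (Fin g) ℂ) (c z : Fin g → ℂ) (k : Fin g → ℤ) :
    gtheta τ c (z + ic k) = cexp (2 * Real.pi * I * (c ⬝ᵥ ic k)) * gtheta τ c z := by
  have h : z + ic k = fun i => z i + k i := rfl
  rw [gtheta_eq, gtheta_eq, ← mul_assoc, ← Complex.exp_add, h, fourierSum_add_int, ← h,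
    dotProduct_add]
  congr 2
  ring

theorem gtheta_neg (τ : Matrix (Fin g) (Fin g) ℂ) (c z : Fin g → ℂ) :
    gtheta τ (-c) (-z) = gtheta τ c z := by
  rw [gtheta, gtheta, ← (Equiv.neg _).tsum_eq]
  refine tsum_congr fun p => ?_
  have : ic (Equiv.neg _ p) + -c = -(ic p + c) := by
    ext i
    simp [ic]
    ring
  rw [this, mulVec_neg, neg_dotProduct, dotProduct_neg, neg_neg, neg_dotProduct, dotProduct_neg,
    neg_neg]

theorem gtheta_add_mulVec {τ : Matrix (Fin g) (Fin g) ℂ} (hτ : τ.IsSymm) (c z v : Fin g → ℂ) :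
    gtheta τ c (z + τ *ᵥ v) =
      cexp (-(Real.pi * I * (v ⬝ᵥ τ *ᵥ v)) - 2 * Real.pi * I * (v ⬝ᵥ z)) *
        gtheta τ (c + v) z := by
  rw [gtheta, gtheta, ← tsum_mul_left]
  refine tsum_congr fun p => ?_
  rw [← Complex.exp_add, ← add_assoc (ic p) c v]
  congr 1
  generalize ic p + c = x
  rw [mulVec_add, dotProduct_add, dotProduct_add, add_dotProduct, add_dotProduct, add_dotProduct,
    dotProduct_mulVec_comm_of_isSymm hτ v x]
  ring

theorem theta_eq_gtheta (m : (Fin g → ℤ) × (Fin g → ℤ)) (τ : Matrix (Fin g) (Fin g) ℂ)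
    (z : Fin g → ℂ) :
    theta m τ z = gtheta τ ((1 / 2 : ℂ) • ic m.1) (z + (1 / 2 : ℂ) • ic m.2) := by
  rw [theta, gtheta]
  refine tsum_congr fun p => ?_
  rw [thetaTerm]
  congr 2
  · congr 1
    simp only [dotProduct, mulVec, Finset.mul_sum, ic, Pi.add_apply, Pi.smul_apply, smul_eq_mul]
    refine Finset.sum_congr rfl fun i _ => Finset.sum_congr rfl fun j _ => ?_
    ring
  · congr 1
    simp only [dotProduct, ic, Pi.add_apply, Pi.smul_apply, smul_eq_mul]
    refine Finset.sum_congr rfl fun i _ => ?_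
    ring

end Gauss

section Riemann

variable {g : ℕ}

/-- The `{0,1}`-valued integer lift of a vector mod 2. -/
def lift (ε : Fin g → ZMod 2) : Fin g → ℤ := fun i => ((ε i).val : ℤ)

/-- Half of an integer vector, as a complex vector. -/
def half (k : Fin g → ℤ) : Fin g → ℂ := (1 / 2 : ℂ) • ic k

theorem ic_add (p q : Fin g → ℤ) : ic (p + q) = ic p + ic q := by
  ext i; simp [ic]

theorem half_add (p q : Fin g → ℤ) : half (p + q) = half p + half q := by
  simp [half, ic_add]

theorem lift_intCast (p : Fin g → ℤ) (i : Fin g) : lift (fun i => (p i : ZMod 2)) i = p i % 2 := by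
  rw [lift, ZMod.val_intCast]
  rfl

/-- Pairs of integer vectors, reorganised by sum and difference. -/
def sumDiffEquiv (g : ℕ) :
    (Fin g → ZMod 2) × ((Fin g → ℤ) × (Fin g → ℤ)) ≃ (Fin g → ℤ) × (Fin g → ℤ) where
  toFun x := (x.2.1 + x.2.2 + lift x.1, x.2.1 - x.2.2)
  invFun y := (fun i => ((y.1 i + y.2 i : ℤ) : ZMod 2),
    (fun i => (y.1 i + y.2 i) / 2, fun i => (y.1 i - y.2 i) / 2))
  left_inv := by
    rintro ⟨ε, r, s⟩
    have h2 : (2 : ZMod 2) = 0 := rfl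
    have hl : ∀ i, 0 ≤ lift ε i ∧ lift ε i < 2 := fun i =>
      ⟨Int.natCast_nonneg _, by unfold lift; exact_mod_cast ZMod.val_lt (ε i)⟩
    refine Prod.ext ?_ (Prod.ext ?_ ?_)
    · funext i
      have : r i + s i + lift ε i + (r i - s i) = 2 * r i + lift ε i := by ring
      simp only [Pi.add_apply, Pi.sub_apply, this]
      push_cast
      simp [h2, lift]
    · funext i
      have := hl i
      simp only [Pi.add_apply, Pi.sub_apply]
      omega
    · funext i
      have := hl i
      simp only [Pi.add_apply, Pi.sub_apply]
      omega
  right_inv := by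
    rintro ⟨p, q⟩
    have hl := lift_intCast (p + q)
    simp only [Pi.add_apply] at hl
    refine Prod.ext ?_ ?_
    · funext i
      have := hl i
      simp only [Pi.add_apply, this]
      omega
    · funext i
      simp only [Pi.sub_apply]
      omega

theorem gtheta_mul_gtheta {τ : Matrix (Fin g) (Fin g) ℂ} (hτ : IsSiegel τ) (c d z w : Fin g → ℂ) :
    gtheta τ c z * gtheta τ d w =
      ∑ ε : Fin g → ZMod 2,
        gtheta ((2 : ℂ) • τ) ((1 / 2 : ℂ) • (c + d) + half (lift ε)) (z + w) *
        gtheta ((2 : ℂ) • τ) ((1 / 2 : ℂ) • (c - d) + half (lift ε)) (z - w) := by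
  have hs := summable_mul_of_summable_norm (summable_norm_gtheta hτ c z)
    (summable_norm_gtheta hτ d w)
  have hs' := (sumDiffEquiv g).summable_iff.mpr hs
  rw [gtheta, gtheta, tsum_mul_tsum_of_summable_norm (summable_norm_gtheta hτ c z)
    (summable_norm_gtheta hτ d w), ← (sumDiffEquiv g).tsum_eq]
  refine (Summable.tsum_prod' hs' fun ε => hs'.prod_factor ε).trans ?_
  rw [tsum_fintype]
  refine Finset.sum_congr rfl fun ε _ => ?_
  rw [gtheta, gtheta, tsum_mul_tsum_of_summable_norm (summable_norm_gtheta (isSiegel_two_smul hτ) _ _)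
    (summable_norm_gtheta (isSiegel_two_smul hτ) _ _)]
  refine tsum_congr ?_
  rintro ⟨r, s⟩
  have h1 : ic ((sumDiffEquiv g (ε, (r, s))).1) + c = (ic r + ((1 / 2 : ℂ) • (c + d) +
      half (lift ε))) + (ic s + ((1 / 2 : ℂ) • (c - d) + half (lift ε))) := by
    ext i
    simp [sumDiffEquiv, ic, half]
    ring
  have h2 : ic ((sumDiffEquiv g (ε, (r, s))).2) + d = (ic r + ((1 / 2 : ℂ) • (c + d) +
      half (lift ε))) - (ic s + ((1 / 2 : ℂ) • (c - d) + half (lift ε))) := by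
    ext i
    simp [sumDiffEquiv, ic, half]
    ring
  simp only [Function.comp_apply]
  rw [← Complex.exp_add, ← Complex.exp_add, h1, h2]
  congr 1
  generalize ic r + ((1 / 2 : ℂ) • (c + d) + half (lift ε)) = x
  generalize ic s + ((1 / 2 : ℂ) • (c - d) + half (lift ε)) = y
  simp only [add_dotProduct, sub_dotProduct, dotProduct_add, dotProduct_sub, mulVec_add,
    mulVec_sub, smul_mulVec, dotProduct_smul, smul_eq_mul]
  ring

theorem sum_exp_lift_dotProduct (k : Fin g → ℤ) :
    ∑ b : Fin g → ZMod 2, cexp (Real.pi * I * (ic (lift b) ⬝ᵥ ic k)) =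
      if ∀ i, Even (k i) then 2 ^ g else 0 := by
  have h1 : ∀ b : Fin g → ZMod 2, cexp (Real.pi * I * (ic (lift b) ⬝ᵥ ic k)) =
      ∏ i, cexp (Real.pi * I * ((b i).val * k i)) := fun b => by
    rw [← Complex.exp_sum, ← Finset.mul_sum]
    simp [dotProduct, ic, lift]
  have h2 : ∀ n : ℤ, ∑ x : ZMod 2, cexp (Real.pi * I * (x.val * n)) =
      if Even n then 2 else 0 := by
    intro n
    have h3 : ∑ x : ZMod 2, cexp (Real.pi * I * (x.val * n)) =
        cexp (Real.pi * I * ((0 : ZMod 2).val * n)) + cexp (Real.pi * I * ((1 : ZMod 2).val * n)) :=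
      Fin.sum_univ_two _
    have h4 : cexp (Real.pi * I * n) = (-1) ^ n := by
      rw [mul_comm, Complex.exp_int_mul, Complex.exp_pi_mul_I]
    rw [h3, ZMod.val_zero, ZMod.val_one]
    simp only [Nat.cast_zero, Nat.cast_one, zero_mul, mul_zero, one_mul, Complex.exp_zero, h4]
    rw [neg_one_zpow_eq_ite]
    split_ifs <;> norm_num
  simp_rw [h1]
  rw [← Fintype.piFinset_univ, ← Finset.prod_univ_sum (fun _ => Finset.univ)
    fun i (x : ZMod 2) => cexp (Real.pi * I * (x.val * k i))]
  simp_rw [h2]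
  split_ifs with h
  · simp [h]
  · push Not at h
    obtain ⟨i, hi⟩ := h
    exact Finset.prod_eq_zero (Finset.mem_univ i) (if_neg (by simpa using hi))

theorem exists_lift_add (a b : Fin g → ZMod 2) :
    ∃ k : Fin g → ℤ, lift a + lift b = lift (a + b) + 2 * k := by
  refine ⟨fun i => (lift a i + lift b i - lift (a + b) i) / 2, funext fun i => ?_⟩
  have h : (2 : ℤ) ∣ lift a i + lift b i - lift (a + b) i := by
    have := (ZMod.intCast_zmod_eq_zero_iff_dvd (lift a i + lift b i - lift (a + b) i) 2).mp
    refine (ZMod.intCast_zmod_eq_zero_iff_dvd _ 2).mp ?_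
    simp [lift]
  simp only [Pi.add_apply, Pi.mul_apply, Pi.ofNat_apply]
  omega

theorem gtheta_half_lift_add (τ : Matrix (Fin g) (Fin g) ℂ) (c z : Fin g → ℂ)
    (a b : Fin g → ZMod 2) :
    gtheta τ (c + half (lift a) + half (lift b)) z = gtheta τ (c + half (lift (a + b))) z := by
  obtain ⟨k, hk⟩ := exists_lift_add a b
  have h : c + half (lift a) + half (lift b) = c + half (lift (a + b)) + ic k := by
    rw [add_assoc, ← half_add, hk]
    ext i
    simp [half, ic]
    ring
  rw [h, gtheta_add_int_char]

theorem gtheta_mul_gtheta_half {τ : Matrix (Fin g) (Fin g) ℂ} (hτ : IsSiegel τ)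
    (c d z w : Fin g → ℂ) (a b : Fin g → ZMod 2) :
    gtheta τ (c + half (lift a)) (z + half (lift b)) *
      gtheta τ (d + half (lift a)) (w + half (lift b)) =
    ∑ ε : Fin g → ZMod 2, cexp (Real.pi * I * (ic (lift b) ⬝ᵥ (c + d))) *
      cexp (Real.pi * I * (ic (lift b) ⬝ᵥ ic (lift ε + lift a))) *
      (gtheta ((2 : ℂ) • τ) ((1 / 2 : ℂ) • (c + d) + half (lift (ε + a))) (z + w) *
        gtheta ((2 : ℂ) • τ) ((1 / 2 : ℂ) • (c - d) + half (lift ε)) (z - w)) := by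
  rw [gtheta_mul_gtheta hτ]
  refine Finset.sum_congr rfl fun ε _ => ?_
  have h1 : (1 / 2 : ℂ) • (c + half (lift a) + (d + half (lift a))) + half (lift ε) =
      (1 / 2 : ℂ) • (c + d) + half (lift ε) + half (lift a) := by
    ext i
    simp [half]
    ring
  have h2 : (1 / 2 : ℂ) • (c + half (lift a) - (d + half (lift a))) = (1 / 2 : ℂ) • (c - d) := by
    congr 1
    abel
  have h3 : z + half (lift b) + (w + half (lift b)) = z + w + ic (lift b) := by
    ext i
    simp [half]
    ring
  have h4 : z + half (lift b) - (w + half (lift b)) = z - w := by abel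
  rw [h1, h2, h3, h4, gtheta_add_int, gtheta_half_lift_add, ← mul_assoc, ← Complex.exp_add]
  congr 3
  rw [dotProduct_comm _ (ic (lift b)), add_assoc, ← half_add, dotProduct_add, half,
    dotProduct_smul, dotProduct_smul, smul_eq_mul, smul_eq_mul]
  ring

theorem even_lift_add_iff (ε ε' a : Fin g → ZMod 2) :
    (∀ i, Even ((lift ε + lift a + (lift ε' + lift a)) i)) ↔ ε' = ε := by
  constructor
  · intro h
    funext i
    have := h i
    simp only [Pi.add_apply, lift] at this
    generalize ε i = x at *
    generalize ε' i = y at *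
    generalize a i = t at *
    revert this
    revert x y t
    decide
  · rintro rfl i
    exact ⟨_, rfl⟩

/-- Riemann's theta relation in terms of `gtheta`. -/
theorem riemann_gtheta {τ : Matrix (Fin g) (Fin g) ℂ} (hτ : IsSiegel τ)
    (c₁ c₂ c₃ c₄ z₁ z₂ z₃ z₄ : Fin g → ℂ) :
    ∑ a : Fin g → ZMod 2, ∑ b : Fin g → ZMod 2,
      cexp (-(Real.pi * I * (ic (lift b) ⬝ᵥ (c₁ + c₂ + (c₃ + c₄))))) *
        ((gtheta τ (c₁ + half (lift a)) (z₁ + half (lift b)) *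
          gtheta τ (c₂ + half (lift a)) (z₂ + half (lift b))) *
        (gtheta τ (c₃ + half (lift a)) (z₃ + half (lift b)) *
          gtheta τ (c₄ + half (lift a)) (z₄ + half (lift b)))) =
    2 ^ g *
      ((gtheta τ ((1 / 2 : ℂ) • (c₁ + c₂ + (c₃ + c₄))) ((1 / 2 : ℂ) • (z₁ + z₂ + (z₃ + z₄))) *
        gtheta τ ((1 / 2 : ℂ) • (c₁ + c₂ - (c₃ + c₄))) ((1 / 2 : ℂ) • (z₁ + z₂ - (z₃ + z₄)))) *
      (gtheta τ ((1 / 2 : ℂ) • (c₁ - c₂ + (c₃ - c₄))) ((1 / 2 : ℂ) • (z₁ - z₂ + (z₃ - z₄))) *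
        gtheta τ ((1 / 2 : ℂ) • (c₁ - c₂ - (c₃ - c₄))) ((1 / 2 : ℂ) • (z₁ - z₂ - (z₃ - z₄))))) := by
  have half_sum : ∀ x y : Fin g → ℂ, (1 / 2 : ℂ) • (x + y) + (1 / 2 : ℂ) • (x - y) = x := by
    intro x y; ext i; simp; ring
  have half_diff : ∀ x y : Fin g → ℂ, (1 / 2 : ℂ) • (x + y) - (1 / 2 : ℂ) • (x - y) = y := by
    intro x y; ext i; simp; ring
  rw [gtheta_mul_gtheta hτ ((1 / 2 : ℂ) • (c₁ + c₂ + (c₃ + c₄))),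
    gtheta_mul_gtheta hτ ((1 / 2 : ℂ) • (c₁ - c₂ + (c₃ - c₄)))]
  simp only [half_sum, half_diff, gtheta_mul_gtheta_half hτ]
  set A : (Fin g → ZMod 2) → ℂ := fun ε =>
    gtheta ((2 : ℂ) • τ) ((1 / 2 : ℂ) • (c₁ + c₂) + half (lift ε)) (z₁ + z₂)
  set B : (Fin g → ZMod 2) → ℂ := fun ε =>
    gtheta ((2 : ℂ) • τ) ((1 / 2 : ℂ) • (c₁ - c₂) + half (lift ε)) (z₁ - z₂)
  set A' : (Fin g → ZMod 2) → ℂ := fun ε =>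
    gtheta ((2 : ℂ) • τ) ((1 / 2 : ℂ) • (c₃ + c₄) + half (lift ε)) (z₃ + z₄)
  set B' : (Fin g → ZMod 2) → ℂ := fun ε =>
    gtheta ((2 : ℂ) • τ) ((1 / 2 : ℂ) • (c₃ - c₄) + half (lift ε)) (z₃ - z₄)
  have key : ∀ a : Fin g → ZMod 2, ∑ b : Fin g → ZMod 2,
      cexp (-(Real.pi * I * (ic (lift b) ⬝ᵥ (c₁ + c₂ + (c₃ + c₄))))) *
        ((∑ ε, cexp (Real.pi * I * (ic (lift b) ⬝ᵥ (c₁ + c₂))) *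
          cexp (Real.pi * I * (ic (lift b) ⬝ᵥ ic (lift ε + lift a))) * (A (ε + a) * B ε)) *
        (∑ ε, cexp (Real.pi * I * (ic (lift b) ⬝ᵥ (c₃ + c₄))) *
          cexp (Real.pi * I * (ic (lift b) ⬝ᵥ ic (lift ε + lift a))) * (A' (ε + a) * B' ε))) =
      2 ^ g * ∑ ε, A (ε + a) * B ε * (A' (ε + a) * B' ε) := by
    intro a
    have h1 : ∀ b : Fin g → ZMod 2,
        cexp (-(Real.pi * I * (ic (lift b) ⬝ᵥ (c₁ + c₂ + (c₃ + c₄))))) *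
        ((∑ ε, cexp (Real.pi * I * (ic (lift b) ⬝ᵥ (c₁ + c₂))) *
          cexp (Real.pi * I * (ic (lift b) ⬝ᵥ ic (lift ε + lift a))) * (A (ε + a) * B ε)) *
        (∑ ε, cexp (Real.pi * I * (ic (lift b) ⬝ᵥ (c₃ + c₄))) *
          cexp (Real.pi * I * (ic (lift b) ⬝ᵥ ic (lift ε + lift a))) * (A' (ε + a) * B' ε))) =
        ∑ ε, ∑ ε', cexp (Real.pi * I * (ic (lift b) ⬝ᵥ ic (lift ε + lift a + (lift ε' + lift a)))) *
          (A (ε + a) * B ε * (A' (ε' + a) * B' ε')) := by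
      intro b
      rw [Finset.sum_mul_sum, Finset.mul_sum]
      refine Finset.sum_congr rfl fun ε _ => ?_
      rw [Finset.mul_sum]
      refine Finset.sum_congr rfl fun ε' _ => ?_
      rw [ic_add (lift ε + lift a), dotProduct_add (ic (lift b)) (c₁ + c₂),
        dotProduct_add (ic (lift b)) (ic (lift ε + lift a)), mul_add, mul_add,
        neg_add, Complex.exp_add, Complex.exp_add]
      have e1 := Complex.exp_ne_zero (Real.pi * I * (ic (lift b) ⬝ᵥ (c₁ + c₂)))
      have e2 := Complex.exp_ne_zero (Real.pi * I * (ic (lift b) ⬝ᵥ (c₃ + c₄)))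
      rw [Complex.exp_neg, Complex.exp_neg]
      field_simp
    simp_rw [h1]
    rw [Finset.sum_comm, Finset.mul_sum]
    refine Finset.sum_congr rfl fun ε _ => ?_
    rw [Finset.sum_comm]
    simp_rw [← Finset.sum_mul, sum_exp_lift_dotProduct, even_lift_add_iff]
    simp
  refine (Finset.sum_congr rfl fun a _ => key a).trans ?_
  rw [← Finset.mul_sum, Finset.sum_comm]
  congr 1
  have h2 : ∀ ε : Fin g → ZMod 2, ∑ a, A (ε + a) * B ε * (A' (ε + a) * B' ε) =
      (∑ δ, A δ * A' δ) * (B ε * B' ε) := by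
    intro ε
    rw [Finset.sum_mul, ← Equiv.sum_comp (Equiv.addLeft ε) fun δ => A δ * A' δ * (B ε * B' ε)]
    refine Finset.sum_congr rfl fun a _ => ?_
    simp only [Equiv.coe_addLeft]
    ring
  simp_rw [h2]
  rw [← Finset.mul_sum]

end Riemann

section Characteristics

variable {g : ℕ}

/-- The nontrivial complex character of `ZMod 2`. -/
def chi (x : ZMod 2) : ℂ := if x = 0 then 1 else -1

theorem chi_zero : chi 0 = 1 := by simp [chi]

theorem chi_one : chi 1 = -1 := by simp [chi]

theorem chi_add (x y : ZMod 2) : chi (x + y) = chi x * chi y := by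
  have h : ∀ x : ZMod 2, x = 0 ∨ x = 1 := by decide
  have h2 : (1 + 1 : ZMod 2) = 0 := rfl
  rcases h x with rfl | rfl <;> rcases h y with rfl | rfl <;>
    simp [chi_zero, chi_one, h2]

theorem chi_mul_self (x : ZMod 2) : chi x * chi x = 1 := by
  rw [← chi_add, CharTwo.add_self_eq_zero, chi_zero]

theorem chi_ne_zero (x : ZMod 2) : chi x ≠ 0 := fun h => by
  simpa [h] using chi_mul_self x

theorem exp_pi_mul_intCast (n : ℤ) : cexp (Real.pi * I * n) = chi (n : ZMod 2) := by
  rw [mul_comm, Complex.exp_int_mul, Complex.exp_pi_mul_I, neg_one_zpow_eq_ite, chi]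
  congr 1
  rw [eq_iff_iff, even_iff_two_dvd]
  exact (ZMod.intCast_zmod_eq_zero_iff_dvd n 2).symm

theorem ic_dotProduct (p q : Fin g → ℤ) : ic p ⬝ᵥ ic q = ((p ⬝ᵥ q : ℤ) : ℂ) := by
  simp [ic, dotProduct]

/-- Reduction of an integer characteristic mod 2. -/
def charMod (M : (Fin g → ℤ) × (Fin g → ℤ)) : ThetaChar g :=
  (fun i => (M.1 i : ZMod 2), fun i => (M.2 i : ZMod 2))

theorem charMod_add (M N : (Fin g → ℤ) × (Fin g → ℤ)) :
    charMod (M + N) = charMod M + charMod N := by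
  ext i <;> simp [charMod]

theorem charMod_sub (M N : (Fin g → ℤ) × (Fin g → ℤ)) :
    charMod (M - N) = charMod M - charMod N := by
  ext i <;> simp [charMod]

theorem charMod_charLift (m : ThetaChar g) : charMod (charLift m) = m := by
  ext i <;> simp [charMod, charLift]

theorem theta_eq_half (M : (Fin g → ℤ) × (Fin g → ℤ)) (τ : Matrix (Fin g) (Fin g) ℂ)
    (z : Fin g → ℂ) : theta M τ z = gtheta τ (half M.1) (z + half M.2) :=
  theta_eq_gtheta M τ z

theorem gtheta_int_shift (τ : Matrix (Fin g) (Fin g) ℂ) (c z : Fin g → ℂ) (k l : Fin g → ℤ) :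
    gtheta τ (c + ic k) (z + ic l) = cexp (2 * Real.pi * I * (c ⬝ᵥ ic l)) * gtheta τ c z := by
  rw [gtheta_add_int_char, gtheta_add_int]

theorem two_pi_half_dotProduct (k l : Fin g → ℤ) :
    2 * Real.pi * I * (half k ⬝ᵥ ic l) = Real.pi * I * ((k ⬝ᵥ l : ℤ) : ℂ) := by
  rw [half, smul_dotProduct, ic_dotProduct, smul_eq_mul]
  ring

theorem exists_theta_eq_chi_mul (M : (Fin g → ℤ) × (Fin g → ℤ)) :
    ∃ x : ZMod 2, ∀ (τ : Matrix (Fin g) (Fin g) ℂ) (z : Fin g → ℂ),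
      theta M τ z = chi x * theta (charLift (charMod M)) τ z := by
  have key : ∀ p : Fin g → ℤ, ∃ k : Fin g → ℤ,
      half p = half (lift fun i => (p i : ZMod 2)) + ic k := fun p => by
    refine ⟨fun i => p i / 2, ?_⟩
    ext i
    have h := lift_intCast p i
    have h2 : (p i : ℂ) = (p i % 2 : ℤ) + 2 * (p i / 2 : ℤ) := by
      exact_mod_cast (Int.emod_add_mul_ediv (p i) 2).symm
    simp only [half, ic, Pi.add_apply, Pi.smul_apply, smul_eq_mul, h]
    rw [h2]
    ring
  obtain ⟨k, hk⟩ := key M.1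
  obtain ⟨l, hl⟩ := key M.2
  refine ⟨(((lift fun i => (M.1 i : ZMod 2)) ⬝ᵥ l : ℤ) : ZMod 2), fun τ z => ?_⟩
  rw [theta_eq_half, theta_eq_half, hk, hl, ← add_assoc, gtheta_int_shift, two_pi_half_dotProduct,
    exp_pi_mul_intCast]
  rfl

/-- The quadratic form `m'·m''` mod 2. -/
def qform (m : ThetaChar g) : ZMod 2 := m.1 ⬝ᵥ m.2

/-- The symplectic form on characteristics mod 2. -/
def sform (m n : ThetaChar g) : ZMod 2 := m.1 ⬝ᵥ n.2 + m.2 ⬝ᵥ n.1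

theorem sform_add_left (m m' n : ThetaChar g) : sform (m + m') n = sform m n + sform m' n := by
  simp only [sform, Prod.fst_add, Prod.snd_add, add_dotProduct]
  ring

theorem sform_add_right (m n n' : ThetaChar g) : sform m (n + n') = sform m n + sform m n' := by
  simp only [sform, Prod.fst_add, Prod.snd_add, dotProduct_add]
  ring

theorem sform_comm (m n : ThetaChar g) : sform m n = sform n m := by
  simp only [sform, dotProduct_comm m.1, dotProduct_comm m.2]
  ring

theorem qform_add (m n : ThetaChar g) : qform (m + n) = qform m + qform n + sform m n := by
  simp only [qform, sform, Prod.fst_add, Prod.snd_add, add_dotProduct, dotProduct_add,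
    dotProduct_comm m.2]
  ring

theorem char_add_self (m : ThetaChar g) : m + m = 0 := by
  ext i <;> exact CharTwo.add_self_eq_zero _

theorem qform_eq_charDot (m : ThetaChar g) : qform m = (charDot m : ZMod 2) := by
  simp [qform, charDot, dotProduct]

theorem isOddChar_iff (m : ThetaChar g) : IsOddChar m ↔ qform m = 1 := by
  rw [IsOddChar, charParity, qform_eq_charDot, neg_one_pow_eq_neg_one_iff_odd (by norm_num),
    ZMod.natCast_eq_one_iff_odd]

theorem isEvenChar_iff (m : ThetaChar g) : IsEvenChar m ↔ qform m = 0 := by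
  rw [IsEvenChar, charParity, qform_eq_charDot, neg_one_pow_eq_one_iff_even (by norm_num),
    ZMod.natCast_eq_zero_iff_even]

/-- The theta function with a characteristic mod 2. -/
def th (τ : Matrix (Fin g) (Fin g) ℂ) (m : ThetaChar g) (z : Fin g → ℂ) : ℂ :=
  theta (charLift m) τ z

/-- The derivative at the origin in direction `u`. -/
def dth (τ : Matrix (Fin g) (Fin g) ℂ) (m : ThetaChar g) (u : Fin g → ℂ) : ℂ :=
  fderiv ℂ (th τ m) 0 u

theorem th_eq_gtheta (τ : Matrix (Fin g) (Fin g) ℂ) (m : ThetaChar g) (z : Fin g → ℂ) :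
    th τ m z = gtheta τ (half (lift m.1)) (z + half (lift m.2)) :=
  theta_eq_half _ τ z

theorem differentiable_th {τ : Matrix (Fin g) (Fin g) ℂ} (hτ : IsSiegel τ) (m : ThetaChar g) :
    Differentiable ℂ (th τ m) := by
  have : th τ m = fun z => gtheta τ (half (lift m.1)) (z + half (lift m.2)) :=
    funext (th_eq_gtheta τ m)
  rw [this]
  exact (differentiable_gtheta hτ _).comp (differentiable_id.add_const _)

theorem lift_dotProduct_cast (a b : Fin g → ZMod 2) :
    ((lift a ⬝ᵥ lift b : ℤ) : ZMod 2) = a ⬝ᵥ b := by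
  simp [lift, dotProduct]

theorem th_neg (τ : Matrix (Fin g) (Fin g) ℂ) (m : ThetaChar g) (z : Fin g → ℂ) :
    th τ m (-z) = chi (qform m) * th τ m z := by
  have h1 : ∀ p : Fin g → ℤ, half p = -half p + ic p := fun p => by
    ext i; simp [half]; ring
  rw [th_eq_gtheta, th_eq_gtheta]
  conv_lhs => rw [h1 (lift m.1), h1 (lift m.2), ← add_assoc, gtheta_int_shift,
    show -z + -half (lift m.2) = -(z + half (lift m.2)) by abel, gtheta_neg]
  congr 1
  rw [neg_dotProduct, mul_neg, two_pi_half_dotProduct, Complex.exp_neg, exp_pi_mul_intCast,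
    lift_dotProduct_cast]
  exact inv_eq_of_mul_eq_one_left (chi_mul_self _)

theorem th_zero_of_odd (τ : Matrix (Fin g) (Fin g) ℂ) {m : ThetaChar g} (hm : qform m = 1) :
    th τ m 0 = 0 := by
  have h := th_neg τ m 0
  rw [neg_zero, hm, chi_one] at h
  linear_combination h / 2

theorem dth_of_even {τ : Matrix (Fin g) (Fin g) ℂ} (hτ : IsSiegel τ) {m : ThetaChar g}
    (hm : qform m = 0) (u : Fin g → ℂ) : dth τ m u = 0 := by
  have h : th τ m = fun z => th τ m (-z) := funext fun z => by
    rw [th_neg, hm, chi_zero, one_mul]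
  have hd : HasFDerivAt (th τ m) (fderiv ℂ (th τ m) 0) (-(0 : Fin g → ℂ)) := by
    rw [neg_zero]; exact (differentiable_th hτ m 0).hasFDerivAt
  have hd2 := hd.comp (0 : Fin g → ℂ) (hasFDerivAt_id (0 : Fin g → ℂ)).neg
  have h3 : HasFDerivAt (th τ m) _ (0 : Fin g → ℂ) := hd2.congr_of_eventuallyEq
    (Filter.Eventually.of_forall fun z => congrFun h z)
  have h4 := congrArg (fun L => L u) h3.fderiv
  simp only [ContinuousLinearMap.comp_apply, _root_.neg_apply, ContinuousLinearMap.id_apply,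
    map_neg] at h4
  rw [dth]
  linear_combination h4 / 2

theorem riemann_theta_int {τ : Matrix (Fin g) (Fin g) ℂ} (hτ : IsSiegel τ)
    (R A B : (Fin g → ℤ) × (Fin g → ℤ)) (z : Fin g → ℂ) :
    ∑ a : Fin g → ZMod 2, ∑ b : Fin g → ZMod 2,
      chi (a ⬝ᵥ (charMod R).2 + b ⬝ᵥ (charMod R).1 + b ⬝ᵥ (charMod (A + B)).1) *
        ((theta (charLift (a, b)) τ z * theta (charLift (a, b) + A) τ 0) *
          (theta (charLift (a, b) + B) τ 0 * theta (charLift (a, b) + (A + B)) τ 0)) =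
    2 ^ g * ((theta (R + (A + B)) τ ((1 / 2 : ℂ) • z) * theta (R - B) τ ((1 / 2 : ℂ) • z)) *
      (theta (R - A) τ ((1 / 2 : ℂ) • z) * theta R τ ((1 / 2 : ℂ) • z))) := by
  have h := riemann_gtheta hτ (ic R.1) (half A.1) (half B.1) (half A.1 + half B.1)
    (z + ic R.2) (half A.2) (half B.2) (half A.2 + half B.2)
  have e1 : ∀ r a b : Fin g → ℤ, (1 / 2 : ℂ) • (ic r + half a + (half b + (half a + half b))) =
      half (r + (a + b)) := fun r a b => by ext i; simp [half, ic]; ring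
  have e2 : ∀ r a b : Fin g → ℤ, (1 / 2 : ℂ) • (ic r + half a - (half b + (half a + half b))) =
      half (r - b) := fun r a b => by ext i; simp [half, ic]; ring
  have e3 : ∀ r a b : Fin g → ℤ, (1 / 2 : ℂ) • (ic r - half a + (half b - (half a + half b))) =
      half (r - a) := fun r a b => by ext i; simp [half, ic]; ring
  have e4 : ∀ r a b : Fin g → ℤ, (1 / 2 : ℂ) • (ic r - half a - (half b - (half a + half b))) =
      half r := fun r a b => by ext i; simp [half, ic]
  have f1 : ∀ x y w : Fin g → ℂ, (1 / 2 : ℂ) • (z + x + y + w) =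
      (1 / 2 : ℂ) • z + (1 / 2 : ℂ) • (x + y + w) := fun x y w => by
    simp only [smul_add]; abel
  have f2 : ∀ x y w : Fin g → ℂ, (1 / 2 : ℂ) • (z + x + y - w) =
      (1 / 2 : ℂ) • z + (1 / 2 : ℂ) • (x + y - w) := fun x y w => by
    simp only [smul_add, smul_sub]; abel
  have f3 : ∀ x y w : Fin g → ℂ, (1 / 2 : ℂ) • (z + x - y + w) =
      (1 / 2 : ℂ) • z + (1 / 2 : ℂ) • (x - y + w) := fun x y w => by
    simp only [smul_add, smul_sub]; abel
  have f4 : ∀ x y w : Fin g → ℂ, (1 / 2 : ℂ) • (z + x - y - w) =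
      (1 / 2 : ℂ) • z + (1 / 2 : ℂ) • (x - y - w) := fun x y w => by
    simp only [smul_add, smul_sub]; abel
  rw [f1, f2, f3, f4, e1, e1, e2, e2, e3, e3, e4, e4] at h
  simp only [theta_eq_half, Prod.fst_add, Prod.snd_add, Prod.fst_sub, Prod.snd_sub]
  rw [← h]
  refine Finset.sum_congr rfl fun a _ => Finset.sum_congr rfl fun b _ => ?_
  have g1 : gtheta τ (ic R.1 + half (lift a)) (z + ic R.2 + half (lift b)) =
      chi (a ⬝ᵥ (charMod R).2) * gtheta τ (half (lift a)) (z + half (lift b)) := by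
    rw [add_comm (ic R.1), add_right_comm z, gtheta_int_shift, two_pi_half_dotProduct,
      exp_pi_mul_intCast]
    congr 2
    simp [dotProduct, lift, charMod]
  have g2 : cexp (-(Real.pi * I * (ic (lift b) ⬝ᵥ
      (ic R.1 + half A.1 + (half B.1 + (half A.1 + half B.1)))))) =
      chi (b ⬝ᵥ (charMod R).1 + b ⬝ᵥ (charMod (A + B)).1) := by
    have : ic R.1 + half A.1 + (half B.1 + (half A.1 + half B.1)) = ic (R.1 + (A.1 + B.1)) := by
      ext i; simp [half, ic]; ring
    rw [this, ic_dotProduct, Complex.exp_neg, exp_pi_mul_intCast, ← dotProduct_add]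
    refine (inv_eq_of_mul_eq_one_left (chi_mul_self _)).trans ?_
    congr 1
    simp [dotProduct, lift, charMod]
  have hl : ∀ a b : Fin g → ZMod 2, charLift (a, b) = (lift a, lift b) := fun _ _ => rfl
  rw [g1, g2, add_assoc, chi_add (a ⬝ᵥ (charMod R).2)]
  simp only [hl, half_add, zero_add]
  rw [add_comm (half A.1) (half (lift a)), add_comm (half A.2) (half (lift b)),
    add_comm (half B.1) (half (lift a)), add_comm (half B.2) (half (lift b)),
    add_comm (half A.1 + half B.1) (half (lift a)), add_comm (half A.2 + half B.2) (half (lift b))]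
  ring

/-- The three-fold product of theta constants attached to a characteristic. -/
def thprod (τ : Matrix (Fin g) (Fin g) ℂ) (α β m : ThetaChar g) : ℂ :=
  th τ (m + α) 0 * th τ (m + β) 0 * th τ (m + (α + β)) 0

theorem riemann_th (α β : ThetaChar g) : ∃ t w : ThetaChar g → ZMod 2,
    ∀ τ : Matrix (Fin g) (Fin g) ℂ, IsSiegel τ → ∀ (r : ThetaChar g) (z : Fin g → ℂ),
    ∑ m : ThetaChar g, chi (sform m r) * chi (t m) * thprod τ α β m * th τ m z =
      2 ^ g * chi (w r) * (th τ (r + (α + β)) ((1 / 2 : ℂ) • z) * th τ (r + β) ((1 / 2 : ℂ) • z) *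
        (th τ (r + α) ((1 / 2 : ℂ) • z) * th τ r ((1 / 2 : ℂ) • z))) := by
  choose x hx using exists_theta_eq_chi_mul (g := g)
  have hx' : ∀ M τ z, theta M τ z = chi (x M) * th τ (charMod M) z := hx
  have hsub : ∀ m n : ThetaChar g, m - n = m + n := fun m n => by
    rw [sub_eq_iff_eq_add, add_assoc, char_add_self, add_zero]
  refine ⟨fun m => m.2 ⬝ᵥ (α + β).1 + x (charLift m + charLift α) + x (charLift m + charLift β) +
      x (charLift m + (charLift α + charLift β)),
    fun r => x (charLift r + (charLift α + charLift β)) + x (charLift r - charLift β) +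
      x (charLift r - charLift α), fun τ hτ r z => ?_⟩
  have h := riemann_theta_int hτ (charLift r) (charLift α) (charLift β) z
  rw [hx' (charLift r + (charLift α + charLift β)), hx' (charLift r - charLift β),
    hx' (charLift r - charLift α)] at h
  simp only [charMod_add, charMod_sub, charMod_charLift, hsub] at h
  have hr : theta (charLift r) τ ((1 / 2 : ℂ) • z) = th τ r ((1 / 2 : ℂ) • z) := rfl
  rw [hr] at h
  simp only [chi_add]
  refine Eq.trans ?_ (h.trans (by ring))
  rw [Fintype.sum_prod_type]
  refine Finset.sum_congr rfl fun a _ => Finset.sum_congr rfl fun b _ => ?_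
  rw [hx' (charLift (a, b) + charLift α), hx' (charLift (a, b) + charLift β),
    hx' (charLift (a, b) + (charLift α + charLift β))]
  have hm : theta (charLift (a, b)) τ z = th τ (a, b) z := rfl
  rw [hm]
  simp only [charMod_add, charMod_charLift, chi_add, thprod, sform]
  ring

end Characteristics

section LinearRelations

variable {g : ℕ}

theorem hasFDerivAt_th_half {τ : Matrix (Fin g) (Fin g) ℂ} (hτ : IsSiegel τ) (m : ThetaChar g) :
    HasFDerivAt (fun z => th τ m ((1 / 2 : ℂ) • z)) ((1 / 2 : ℂ) • fderiv ℂ (th τ m) 0) 0 := by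
  have h1 : HasFDerivAt (th τ m) (fderiv ℂ (th τ m) 0) ((1 / 2 : ℂ) • (0 : Fin g → ℂ)) := by
    rw [smul_zero]; exact (differentiable_th hτ m 0).hasFDerivAt
  have h2 : HasFDerivAt (fun z : Fin g → ℂ => (1 / 2 : ℂ) • z)
      ((1 / 2 : ℂ) • ContinuousLinearMap.id ℂ (Fin g → ℂ)) 0 :=
    (hasFDerivAt_id (0 : Fin g → ℂ)).const_smul (1 / 2 : ℂ)
  have h3 := h1.comp (0 : Fin g → ℂ) h2
  rwa [ContinuousLinearMap.comp_smul, ContinuousLinearMap.comp_id] at h3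

theorem exists_riemann_dth (α β : ThetaChar g) : ∃ t w : ThetaChar g → ZMod 2,
    ∀ τ : Matrix (Fin g) (Fin g) ℂ, IsSiegel τ → ∀ (r : ThetaChar g) (u : Fin g → ℂ),
    ∑ m : ThetaChar g, chi (sform m r) * chi (t m) * thprod τ α β m * dth τ m u =
      2 ^ g * chi (w r) * (1 / 2 *
        (dth τ (r + (α + β)) u * th τ (r + β) 0 * th τ (r + α) 0 * th τ r 0 +
          th τ (r + (α + β)) 0 * dth τ (r + β) u * th τ (r + α) 0 * th τ r 0 +
          th τ (r + (α + β)) 0 * th τ (r + β) 0 * dth τ (r + α) u * th τ r 0 +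
          thprod τ α β r * dth τ r u)) := by
  obtain ⟨t, w, h⟩ := riemann_th α β
  refine ⟨t, w, fun τ hτ r u => ?_⟩
  have hL : HasFDerivAt
      (fun z => ∑ m : ThetaChar g, chi (sform m r) * chi (t m) * thprod τ α β m * th τ m z)
      (∑ m : ThetaChar g, (chi (sform m r) * chi (t m) * thprod τ α β m) •
        fderiv ℂ (th τ m) 0) 0 :=
    HasFDerivAt.fun_sum fun m _ => (differentiable_th hτ m 0).hasFDerivAt.const_mul _
  have hR := (((hasFDerivAt_th_half hτ (r + (α + β))).fun_mul
    (hasFDerivAt_th_half hτ (r + β))).fun_mul ((hasFDerivAt_th_half hτ (r + α)).fun_mul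
      (hasFDerivAt_th_half hτ r))).const_mul (2 ^ g * chi (w r))
  have hE := (hL.congr_of_eventuallyEq (Filter.Eventually.of_forall fun z =>
    (h τ hτ r z).symm)).unique hR
  have hu := congrArg (fun L => L u) hE
  simp only [_root_.sum_apply, _root_.smul_apply, _root_.add_apply, smul_eq_mul, smul_zero] at hu
  simp only [dth, thprod]
  refine hu.trans ?_
  ring

/-- The combinatorial condition under which four odd theta functions have linearly related
gradients. -/
def IsRelated {V : Type*} [AddCommGroup V] (q : V → ZMod 2) (s : V → V → ZMod 2)
    (n : Fin 4 → V) (α β : V) : Prop :=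
  (∀ i, q (n i) = 1 ∧ q (n i + α) = 0 ∧ q (n i + β) = 0 ∧ q (n i + (α + β)) = 0) ∧
  (∀ i, (i = 0 ∨ i = 1) → q (n i + ∑ j, n j) = 0 ∧ q (n i + ∑ j, n j + α) = 1 ∧
    q (n i + ∑ j, n j + β) = 1 ∧ q (n i + ∑ j, n j + (α + β)) = 1) ∧
  n 2 ≠ n 3 ∧ s (n 2 + n 3) (n 0 + n 1) = 0 ∧ s (n 2 + n 3) (∑ j, n j) = 0 ∧
  ∀ m, q m = 1 → q (m + α) = 0 → q (m + β) = 0 → q (m + (α + β)) = 0 →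
    s (m + n 2) (n 0 + n 1) = 0 → s (m + n 2) (∑ j, n j) = 0 → m = n 2 ∨ m = n 3

theorem qform_eq_zero_or_one (m : ThetaChar g) : qform m = 0 ∨ qform m = 1 := by
  generalize qform m = a
  revert a
  decide

theorem thprod_mul_dth_eq_zero {τ : Matrix (Fin g) (Fin g) ℂ} (hτ : IsSiegel τ)
    {α β m : ThetaChar g}
    (h : ¬(qform m = 1 ∧ qform (m + α) = 0 ∧ qform (m + β) = 0 ∧ qform (m + (α + β)) = 0))
    (u : Fin g → ℂ) : thprod τ α β m * dth τ m u = 0 := by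
  rcases qform_eq_zero_or_one m with h0 | h0
  · rw [dth_of_even hτ h0, mul_zero]
  rcases qform_eq_zero_or_one (m + α) with h1 | h1
  · rcases qform_eq_zero_or_one (m + β) with h2 | h2
    · rcases qform_eq_zero_or_one (m + (α + β)) with h3 | h3
      · exact absurd ⟨h0, h1, h2, h3⟩ h
      · rw [thprod, th_zero_of_odd τ h3]; ring
    · rw [thprod, th_zero_of_odd τ h2]; ring
  · rw [thprod, th_zero_of_odd τ h1]; ring

theorem exists_linear_relation {n : Fin 4 → ThetaChar 3} {α β : ThetaChar 3}
    (hn : IsRelated qform sform n α β) : ∃ ε : Fin 4 → ZMod 2,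
    ∀ τ : Matrix (Fin 3) (Fin 3) ℂ, IsSiegel τ → ∀ u : Fin 3 → ℂ,
      ∑ i, chi (ε i) * thprod τ α β (n i) * dth τ (n i) u = 0 := by
  obtain ⟨h1, h2, h23, ho1, ho2, huniq⟩ := hn
  obtain ⟨t, w, h⟩ := exists_riemann_dth α β
  set s := ∑ j, n j with hs
  refine ⟨![1 + w (n 0) + sform (n 0) (n 2), 1 + w (n 1) + sform (n 1) (n 2), t (n 2),
    t (n 3) + sform (n 0) (n 3 + n 2)], fun τ hτ u => ?_⟩
  have hodd : ∀ i, ∑ m : ThetaChar 3, chi (sform m (n i)) * chi (t m) * thprod τ α β m *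
      dth τ m u = 4 * chi (w (n i)) * (thprod τ α β (n i) * dth τ (n i) u) := fun i => by
    obtain ⟨a0, a1, a2, a3⟩ := h1 i
    rw [h τ hτ, dth_of_even hτ a1, dth_of_even hτ a2, dth_of_even hτ a3]
    ring
  have heven : ∀ i, (i = 0 ∨ i = 1) → ∑ m : ThetaChar 3, chi (sform m (n i + s)) * chi (t m) *
      thprod τ α β m * dth τ m u = 0 := fun i hi => by
    obtain ⟨a0, a1, a2, a3⟩ := h2 i hi
    rw [h τ hτ, thprod, th_zero_of_odd τ a1, th_zero_of_odd τ a2, th_zero_of_odd τ a3]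
    ring
  have hsum : ∀ m : ThetaChar 3,
      chi (sform (n 0) (n 2)) * chi (sform m (n 0)) +
        chi (sform (n 1) (n 2)) * chi (sform m (n 1)) +
        chi (sform (n 0 + s) (n 2)) * chi (sform m (n 0 + s)) +
        chi (sform (n 1 + s) (n 2)) * chi (sform m (n 1 + s)) =
      chi (sform (n 0) (m + n 2)) * (1 + chi (sform (m + n 2) (n 0 + n 1))) *
        (1 + chi (sform (m + n 2) s)) := fun m => by
    simp only [sform_add_left, sform_add_right, chi_add, sform_comm (n 0), sform_comm (n 1),
      sform_comm s]
    linear_combination (-chi (sform m (n 1)) * chi (sform (n 2) (n 1)) *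
      (1 + chi (sform m s) * chi (sform (n 2) s))) *
      (chi_mul_self (sform m (n 0)) * chi (sform (n 2) (n 0)) * chi (sform (n 2) (n 0)) + chi_mul_self (sform (n 2) (n 0)))
  have hterm : ∀ m : ThetaChar 3, m ≠ n 2 → m ≠ n 3 →
      (1 + chi (sform (m + n 2) (n 0 + n 1))) * (1 + chi (sform (m + n 2) s)) *
        (thprod τ α β m * dth τ m u) = 0 := fun m hm2 hm3 => by
    by_cases hm : qform m = 1 ∧ qform (m + α) = 0 ∧ qform (m + β) = 0 ∧ qform (m + (α + β)) = 0
    · have hz : ∀ x : ZMod 2, x ≠ 0 → 1 + chi x = 0 := fun x hx => by simp [chi, hx]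
      by_cases ha : sform (m + n 2) (n 0 + n 1) = 0
      · by_cases hb : sform (m + n 2) s = 0
        · rcases huniq m hm.1 hm.2.1 hm.2.2.1 hm.2.2.2 ha hb with h | h
          exacts [absurd h hm2, absurd h hm3]
        · rw [hz _ hb]; ring
      · rw [hz _ ha]; ring
    · rw [thprod_mul_dth_eq_zero hτ hm, mul_zero]
  have htot : ∑ m : ThetaChar 3, chi (sform (n 0) (m + n 2)) * chi (t m) *
      ((1 + chi (sform (m + n 2) (n 0 + n 1))) * (1 + chi (sform (m + n 2) s)) *
        (thprod τ α β m * dth τ m u)) =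
      4 * (chi (sform (n 0) (n 2)) * chi (w (n 0)) * (thprod τ α β (n 0) * dth τ (n 0) u) +
        chi (sform (n 1) (n 2)) * chi (w (n 1)) * (thprod τ α β (n 1) * dth τ (n 1) u)) := by
    have e : 4 * (chi (sform (n 0) (n 2)) * chi (w (n 0)) *
          (thprod τ α β (n 0) * dth τ (n 0) u) +
        chi (sform (n 1) (n 2)) * chi (w (n 1)) * (thprod τ α β (n 1) * dth τ (n 1) u)) =
        chi (sform (n 0) (n 2)) * (∑ m : ThetaChar 3, chi (sform m (n 0)) * chi (t m) *
          thprod τ α β m * dth τ m u) +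
        chi (sform (n 1) (n 2)) * (∑ m : ThetaChar 3, chi (sform m (n 1)) * chi (t m) *
          thprod τ α β m * dth τ m u) +
        chi (sform (n 0 + s) (n 2)) * (∑ m : ThetaChar 3, chi (sform m (n 0 + s)) * chi (t m) *
          thprod τ α β m * dth τ m u) +
        chi (sform (n 1 + s) (n 2)) * (∑ m : ThetaChar 3, chi (sform m (n 1 + s)) * chi (t m) *
          thprod τ α β m * dth τ m u) := by
      rw [hodd, hodd, heven 0 (Or.inl rfl), heven 1 (Or.inr rfl)]
      ring
    rw [e]
    rw [Finset.mul_sum, Finset.mul_sum, Finset.mul_sum, Finset.mul_sum, ← Finset.sum_add_distrib,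
      ← Finset.sum_add_distrib, ← Finset.sum_add_distrib]
    refine Finset.sum_congr rfl fun m _ => ?_
    linear_combination (-chi (t m) * thprod τ α β m * dth τ m u) * hsum m
  have hpair : ∑ m : ThetaChar 3, chi (sform (n 0) (m + n 2)) * chi (t m) *
      ((1 + chi (sform (m + n 2) (n 0 + n 1))) * (1 + chi (sform (m + n 2) s)) *
        (thprod τ α β m * dth τ m u)) =
      4 * (chi (t (n 2)) * (thprod τ α β (n 2) * dth τ (n 2) u)) +
      4 * (chi (sform (n 0) (n 3 + n 2)) * chi (t (n 3)) *
        (thprod τ α β (n 3) * dth τ (n 3) u)) := by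
    rw [Fintype.sum_eq_add (n 2) (n 3) h23 fun m hm => by rw [hterm m hm.1 hm.2, mul_zero]]
    have hz : ∀ x : ThetaChar 3, sform x 0 = 0 ∧ sform 0 x = 0 := fun x => by simp [sform]
    rw [char_add_self, (hz _).1, (hz _).2, (hz _).2, add_comm (n 3), ho1, ho2, chi_zero]
    ring
  rw [htot] at hpair
  rw [Fin.sum_univ_four]
  simp only [Matrix.cons_val, chi_add, chi_one]
  linear_combination (-1 / 4 : ℂ) * hpair

end LinearRelations

section Frames

/-- Eight characteristics with odd pairwise sums and total sum zero. -/
def IsFrame (y : Fin 8 → ThetaChar 3) : Prop :=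
  (∀ i j, i ≠ j → qform (y i + y j) = 1) ∧ ∑ i, y i = 0

theorem IsFrame.comp {y : Fin 8 → ThetaChar 3} (hy : IsFrame y) (σ : Equiv.Perm (Fin 8)) :
    IsFrame (fun i => y (σ i)) :=
  ⟨fun _ _ hij => hy.1 _ _ (σ.injective.ne hij), (Equiv.sum_comp σ y).trans hy.2⟩

theorem exists_isFrame : ∃ y : Fin 8 → ThetaChar 3, IsFrame y := by
  refine ⟨![0, (![0, 0, 1], ![0, 0, 1]), (![0, 1, 0], ![0, 1, 1]), (![0, 1, 1], ![1, 1, 0]),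
    (![1, 0, 0], ![1, 1, 1]), (![1, 0, 1], ![1, 0, 0]), (![1, 1, 0], ![1, 0, 1]),
    (![1, 1, 1], ![0, 1, 0])], ?_⟩
  unfold IsFrame qform
  decide

theorem qform_smul (c : ZMod 2) (m : ThetaChar 3) : qform (c • m) = c * qform m := by
  have : ∀ c : ZMod 2, c * c = c := by decide
  simp only [qform, Prod.smul_fst, Prod.smul_snd, smul_dotProduct, dotProduct_smul, smul_eq_mul]
  rw [← mul_assoc, this]

theorem sform_smul_left (c : ZMod 2) (m n : ThetaChar 3) : sform (c • m) n = c * sform m n := by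
  simp only [sform, Prod.smul_fst, Prod.smul_snd, smul_dotProduct, smul_eq_mul]
  ring

theorem sform_smul_right (c : ZMod 2) (m n : ThetaChar 3) : sform m (c • n) = c * sform m n := by
  rw [sform_comm, sform_smul_left, sform_comm]

/-- The coordinate model of the quadratic form. -/
def coordForm (c : Fin 6 → ZMod 2) : ZMod 2 :=
  c 0 + c 1 + c 2 + c 3 + c 4 + c 5 + c 0 * (c 1 + c 2 + c 3 + c 4 + c 5) +
    c 1 * (c 2 + c 3 + c 4 + c 5) + c 2 * (c 3 + c 4 + c 5) + c 3 * (c 4 + c 5) + c 4 * c 5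

/-- The coordinate model of the symplectic form. -/
def coordPairing (c d : Fin 6 → ZMod 2) : ZMod 2 := coordForm (c + d) + coordForm c + coordForm d

/-- The coordinate isomorphism attached to a frame. -/
def frameMap (y : Fin 8 → ThetaChar 3) (c : Fin 6 → ZMod 2) : ThetaChar 3 :=
  c 0 • (y 0 + y 6) + c 1 • (y 1 + y 6) + c 2 • (y 2 + y 6) + c 3 • (y 3 + y 6) +
    c 4 • (y 4 + y 6) + c 5 • (y 5 + y 6)

theorem frameMap_add (y : Fin 8 → ThetaChar 3) (c d : Fin 6 → ZMod 2) :
    frameMap y (c + d) = frameMap y c + frameMap y d := by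
  simp only [frameMap, Pi.add_apply, add_smul]
  abel

theorem sform_eq (m n : ThetaChar 3) : sform m n = qform (m + n) + qform m + qform n := by
  rw [qform_add]
  have : ∀ a b c : ZMod 2, c = a + b + c + a + b := by decide
  exact this _ _ _

theorem qform_frameMap {y : Fin 8 → ThetaChar 3} (hy : IsFrame y) (c : Fin 6 → ZMod 2) :
    qform (frameMap y c) = coordForm c := by
  have h1 : ∀ i : Fin 8, i ≠ 6 → qform (y i + y 6) = 1 := fun i hi => hy.1 i 6 hi
  have h2 : ∀ i j : Fin 8, i ≠ j → i ≠ 6 → j ≠ 6 → sform (y i + y 6) (y j + y 6) = 1 :=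
    fun i j hij hi hj => by
      rw [sform_eq, h1 i hi, h1 j hj, show y i + y 6 + (y j + y 6) = y i + y j + (y 6 + y 6) by abel,
        char_add_self, add_zero, hy.1 i j hij]
      decide
  rw [frameMap]
  obtain ⟨v, hv⟩ : ∃ v, v = fun i => y i + y 6 := ⟨_, rfl⟩
  have e : ∀ i, y i + y 6 = v i := fun i => (congrFun hv i).symm
  simp only [e] at h1 h2 ⊢
  simp only [qform_add, sform_add_left, qform_smul, sform_smul_left, sform_smul_right]
  rw [h1 0 (by decide), h1 1 (by decide), h1 2 (by decide), h1 3 (by decide), h1 4 (by decide),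
    h1 5 (by decide)]
  rw [h2 0 1 (by decide) (by decide) (by decide), h2 0 2 (by decide) (by decide) (by decide),
    h2 0 3 (by decide) (by decide) (by decide), h2 0 4 (by decide) (by decide) (by decide),
    h2 0 5 (by decide) (by decide) (by decide), h2 1 2 (by decide) (by decide) (by decide),
    h2 1 3 (by decide) (by decide) (by decide), h2 1 4 (by decide) (by decide) (by decide),
    h2 1 5 (by decide) (by decide) (by decide), h2 2 3 (by decide) (by decide) (by decide),
    h2 2 4 (by decide) (by decide) (by decide), h2 2 5 (by decide) (by decide) (by decide),
    h2 3 4 (by decide) (by decide) (by decide), h2 3 5 (by decide) (by decide) (by decide),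
    h2 4 5 (by decide) (by decide) (by decide)]
  rw [coordForm]
  ring

theorem sform_frameMap {y : Fin 8 → ThetaChar 3} (hy : IsFrame y) (c d : Fin 6 → ZMod 2) :
    sform (frameMap y c) (frameMap y d) = coordPairing c d := by
  rw [sform_eq, ← frameMap_add, qform_frameMap hy, qform_frameMap hy, qform_frameMap hy,
    coordPairing]

theorem frameMap_injective {y : Fin 8 → ThetaChar 3} (hy : IsFrame y) :
    Function.Injective (frameMap y) := fun c d hcd => by
  have key : ∀ c : Fin 6 → ZMod 2, (∀ i, coordPairing c (Pi.single i 1) = 0) → c = 0 := by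
    unfold coordPairing coordForm
    decide
  have h := key (c + d) fun i => by
    rw [← sform_frameMap hy, frameMap_add, hcd, char_add_self]
    simp [sform]
  ext i
  exact CharTwo.add_eq_zero.1 (congrFun h i)

theorem frameMap_bijective {y : Fin 8 → ThetaChar 3} (hy : IsFrame y) :
    Function.Bijective (frameMap y) := by
  refine (Fintype.bijective_iff_injective_and_card _).2 ⟨frameMap_injective hy, ?_⟩
  simp [ThetaChar, ZMod.card]

theorem isRelated_frameMap {y : Fin 8 → ThetaChar 3} (hy : IsFrame y)
    {n : Fin 4 → Fin 6 → ZMod 2} {α β : Fin 6 → ZMod 2}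
    (h : IsRelated coordForm coordPairing n α β) :
    IsRelated qform sform (fun i => frameMap y (n i)) (frameMap y α) (frameMap y β) := by
  have hs : ∑ i, frameMap y (n i) = frameMap y (∑ i, n i) := by
    simp only [Fin.sum_univ_four, frameMap_add]
  obtain ⟨h1, h2, h3, h4, h5, h6⟩ := h
  refine ⟨?_, ?_, ?_, ?_, ?_, ?_⟩
  · simpa only [← frameMap_add, qform_frameMap hy] using h1
  · simpa only [hs, ← frameMap_add, qform_frameMap hy] using h2
  · exact (frameMap_injective hy).ne h3
  · simpa only [← frameMap_add, sform_frameMap hy] using h4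
  · simpa only [hs, ← frameMap_add, sform_frameMap hy] using h5
  · intro m
    obtain ⟨c, rfl⟩ := (frameMap_bijective hy).2 m
    simpa only [hs, ← frameMap_add, sform_frameMap hy, qform_frameMap hy,
      (frameMap_injective hy).eq_iff] using h6 c

theorem IsFrame.apply_seven {y : Fin 8 → ThetaChar 3} (hy : IsFrame y) :
    y 7 = y 0 + y 1 + y 2 + y 3 + y 4 + y 5 + y 6 := by
  have h := hy.2
  rw [Fin.sum_univ_eight] at h
  rw [← sub_eq_zero, ← h, sub_eq_iff_eq_add]
  have := char_add_self (y 0 + y 1 + y 2 + y 3 + y 4 + y 5 + y 6)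
  rw [add_right_comm, this, zero_add]

/-- The four terms of the linear relation at a vertex of the frame. -/
theorem exists_star_relation {y : Fin 8 → ThetaChar 3} (hy : IsFrame y) : ∃ ε : Fin 4 → ZMod 2,
    ∀ τ : Matrix (Fin 3) (Fin 3) ℂ, IsSiegel τ → ∀ u : Fin 3 → ℂ,
      ∑ i, chi (ε i) * thprod τ (y 5 + y 6) (y 5 + y 7)
        (![y 0 + y 1, y 0 + y 2, y 0 + y 3, y 0 + y 4] i) *
          dth τ (![y 0 + y 1, y 0 + y 2, y 0 + y 3, y 0 + y 4] i) u = 0 := by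
  have hrel : IsRelated coordForm coordPairing
      ![![1, 1, 0, 0, 0, 0], ![1, 0, 1, 0, 0, 0], ![1, 0, 0, 1, 0, 0], ![1, 0, 0, 0, 1, 0]]
      ![0, 0, 0, 0, 0, 1] ![1, 1, 1, 1, 1, 0] := by
    unfold IsRelated coordPairing coordForm
    decide
  have h := exists_linear_relation (isRelated_frameMap hy hrel)
  have hn : ![y 0 + y 1, y 0 + y 2, y 0 + y 3, y 0 + y 4] = fun i => frameMap y
      (![![1, 1, 0, 0, 0, 0], ![1, 0, 1, 0, 0, 0], ![1, 0, 0, 1, 0, 0], ![1, 0, 0, 0, 1, 0]] i) := by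
    have h6 := char_add_self (y 6)
    funext i
    fin_cases i <;> simp [frameMap] <;> rw [add_add_add_comm, h6, add_zero]
  have ha : y 5 + y 6 = frameMap y ![0, 0, 0, 0, 0, 1] := by simp [frameMap]
  have hb : y 5 + y 7 = frameMap y ![1, 1, 1, 1, 1, 0] := by
    have e1 : y 5 + y 7 = y 0 + y 1 + y 2 + y 3 + y 4 + (y 5 + y 5) + y 6 := by
      rw [hy.apply_seven]; abel
    have e2 : y 0 + y 6 + (y 1 + y 6) + (y 2 + y 6) + (y 3 + y 6) + (y 4 + y 6) =
        y 0 + y 1 + y 2 + y 3 + y 4 + ((y 6 + y 6) + (y 6 + y 6)) + y 6 := by abel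
    simp [frameMap]
    rw [e1, e2, char_add_self, char_add_self, add_zero]
  rw [hn, ha, hb]
  exact h

theorem exists_edge_relation {y : Fin 8 → ThetaChar 3} (hy : IsFrame y) : ∃ ε : Fin 4 → ZMod 2,
    ∀ τ : Matrix (Fin 3) (Fin 3) ℂ, IsSiegel τ → ∀ u : Fin 3 → ℂ,
      ∑ i, chi (ε i) * thprod τ (y 4 + y 5) (y 0 + y 4 + y 6 + y 7)
        (![y 0 + y 1, y 0 + y 2, y 0 + y 3, y 4 + y 5] i) *
          dth τ (![y 0 + y 1, y 0 + y 2, y 0 + y 3, y 4 + y 5] i) u = 0 := by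
  have hrel : IsRelated coordForm coordPairing
      ![![1, 1, 0, 0, 0, 0], ![1, 0, 1, 0, 0, 0], ![1, 0, 0, 1, 0, 0], ![0, 0, 0, 0, 1, 1]]
      ![0, 0, 0, 0, 1, 1] ![0, 1, 1, 1, 0, 1] := by
    unfold IsRelated coordPairing coordForm
    decide
  have h := exists_linear_relation (isRelated_frameMap hy hrel)
  have hn : ![y 0 + y 1, y 0 + y 2, y 0 + y 3, y 4 + y 5] = fun i => frameMap y
      (![![1, 1, 0, 0, 0, 0], ![1, 0, 1, 0, 0, 0], ![1, 0, 0, 1, 0, 0], ![0, 0, 0, 0, 1, 1]] i) := by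
    have h6 := char_add_self (y 6)
    funext i
    fin_cases i <;> simp [frameMap] <;> rw [add_add_add_comm, h6, add_zero]
  have ha : y 4 + y 5 = frameMap y ![0, 0, 0, 0, 1, 1] := by
    simp [frameMap]
    rw [add_add_add_comm, char_add_self, add_zero]
  have hb : y 0 + y 4 + y 6 + y 7 = frameMap y ![0, 1, 1, 1, 0, 1] := by
    have e1 : y 0 + y 4 + y 6 + y 7 =
        y 1 + y 2 + y 3 + y 5 + ((y 0 + y 0) + (y 4 + y 4) + (y 6 + y 6)) := by
      rw [hy.apply_seven]; abel
    have e2 : y 1 + y 6 + (y 2 + y 6) + (y 3 + y 6) + (y 5 + y 6) =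
        y 1 + y 2 + y 3 + y 5 + ((y 6 + y 6) + (y 6 + y 6)) := by abel
    simp [frameMap]
    rw [e1, e2]
    simp only [char_add_self, add_zero]
  rw [hn, ha, hb]
  exact h

end Frames

section SecondOrder

variable {g : ℕ}

/-- The second order theta functions. -/
def kum (τ : Matrix (Fin g) (Fin g) ℂ) (ε : Fin g → ZMod 2) (Z : Fin g → ℂ) : ℂ :=
  gtheta ((2 : ℂ) • τ) (half (lift ε)) Z

/-- Directional derivative of a second order theta function. -/
def dkum (τ : Matrix (Fin g) (Fin g) ℂ) (u : Fin g → ℂ) (ε : Fin g → ZMod 2) (Z : Fin g → ℂ) : ℂ :=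
  fderiv ℂ (kum τ ε) Z u

theorem differentiable_kum {τ : Matrix (Fin g) (Fin g) ℂ} (hτ : IsSiegel τ)
    (ε : Fin g → ZMod 2) : Differentiable ℂ (kum τ ε) :=
  differentiable_gtheta (isSiegel_two_smul hτ) _

theorem differentiable_dkum {τ : Matrix (Fin g) (Fin g) ℂ} (hτ : IsSiegel τ) (u : Fin g → ℂ)
    (ε : Fin g → ZMod 2) : Differentiable ℂ (dkum τ u ε) :=
  differentiable_fderiv_gtheta (isSiegel_two_smul hτ) _ u

theorem th_mul_th {τ : Matrix (Fin g) (Fin g) ℂ} (hτ : IsSiegel τ) (a b : Fin g → ZMod 2)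
    (z w : Fin g → ℂ) :
    th τ (a, b) z * th τ (a, b) w = ∑ ε : Fin g → ZMod 2,
      chi (b ⬝ᵥ (ε + a)) * (kum τ (ε + a) (z + w) * kum τ ε (z - w)) := by
  have h := gtheta_mul_gtheta_half hτ 0 0 z w a b
  simp only [zero_add] at h
  rw [th_eq_gtheta, th_eq_gtheta]
  refine h.trans (Finset.sum_congr rfl fun ε _ => ?_)
  rw [ic_dotProduct, exp_pi_mul_intCast]
  have e1 : ((lift b ⬝ᵥ (lift ε + lift a) : ℤ) : ZMod 2) = b ⬝ᵥ (ε + a) := by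
    rw [dotProduct_add, dotProduct_add, Int.cast_add, lift_dotProduct_cast, lift_dotProduct_cast]
  rw [e1]
  simp [kum]

theorem kum_neg (τ : Matrix (Fin g) (Fin g) ℂ) (ε : Fin g → ZMod 2) (Z : Fin g → ℂ) :
    kum τ ε (-Z) = kum τ ε Z := by
  have h : half (lift ε) = -half (lift ε) + ic (lift ε) := by
    ext i; simp [half]; ring
  rw [kum, h, gtheta_add_int_char, gtheta_neg]
  rfl

theorem dkum_neg {τ : Matrix (Fin g) (Fin g) ℂ} (hτ : IsSiegel τ) (u : Fin g → ℂ)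
    (ε : Fin g → ZMod 2) (Z : Fin g → ℂ) : dkum τ u ε (-Z) = -dkum τ u ε Z := by
  have hd := ((differentiable_kum hτ ε (-Z)).hasFDerivAt).comp Z (hasFDerivAt_id Z).neg
  have h3 : HasFDerivAt (kum τ ε) _ Z := hd.congr_of_eventuallyEq
    (Filter.Eventually.of_forall fun z => (kum_neg τ ε z).symm)
  have h4 := congrArg (fun L => L u) h3.fderiv
  simp only [ContinuousLinearMap.comp_apply, _root_.neg_apply, ContinuousLinearMap.id_apply,
    map_neg] at h4
  rw [dkum, dkum, h4, neg_neg]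

theorem sum_chi_dotProduct (ε ε' : Fin g → ZMod 2) :
    ∑ b : Fin g → ZMod 2, chi (b ⬝ᵥ ε) * chi (b ⬝ᵥ ε') = if ε = ε' then 2 ^ g else 0 := by
  have h : ∀ b : Fin g → ZMod 2, chi (b ⬝ᵥ ε) * chi (b ⬝ᵥ ε') =
      cexp (Real.pi * I * (ic (lift b) ⬝ᵥ ic (lift ε + lift ε'))) := fun b => by
    rw [ic_dotProduct, exp_pi_mul_intCast, dotProduct_add, Int.cast_add, lift_dotProduct_cast,
      lift_dotProduct_cast, chi_add]
  simp_rw [h]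
  rw [sum_exp_lift_dotProduct]
  congr 1
  rw [eq_iff_iff, funext_iff]
  refine forall_congr' fun i => ?_
  simp only [Pi.add_apply, lift]
  generalize ε i = x
  generalize ε' i = y
  revert x y
  decide

theorem dkum_mul_kum {τ : Matrix (Fin g) (Fin g) ℂ} (hτ : IsSiegel τ) {u : Fin g → ℂ}
    (hu : ∀ m, dth τ m u = 0) (ε ε' : Fin g → ZMod 2) (Z : Fin g → ℂ) :
    dkum τ u ε Z * kum τ ε' Z = kum τ ε Z * dkum τ u ε' Z := by
  have key : ∀ a b : Fin g → ZMod 2, ∑ ε : Fin g → ZMod 2, chi (b ⬝ᵥ (ε + a)) *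
      (dkum τ u (ε + a) Z * kum τ ε Z - kum τ (ε + a) Z * dkum τ u ε Z) = 0 := fun a b => by
    have hL : HasFDerivAt (fun x => th τ (a, b) x * th τ (a, b) Z)
        (th τ (a, b) Z • fderiv ℂ (th τ (a, b)) 0) 0 :=
      (differentiable_th hτ (a, b) 0).hasFDerivAt.mul_const _
    have h1 : ∀ ε : Fin g → ZMod 2, HasFDerivAt (fun x => kum τ ε (x + Z))
        (fderiv ℂ (kum τ ε) Z) 0 := fun ε => by
      have := (differentiable_kum hτ ε (0 + Z)).hasFDerivAt.comp (0 : Fin g → ℂ)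
        ((hasFDerivAt_id (0 : Fin g → ℂ)).add_const Z)
      rwa [ContinuousLinearMap.comp_id, zero_add] at this
    have h2 : ∀ ε : Fin g → ZMod 2, HasFDerivAt (fun x => kum τ ε (x - Z))
        (fderiv ℂ (kum τ ε) (-Z)) 0 := fun ε => by
      have := (differentiable_kum hτ ε (0 - Z)).hasFDerivAt.comp (0 : Fin g → ℂ)
        ((hasFDerivAt_id (0 : Fin g → ℂ)).sub_const Z)
      rwa [ContinuousLinearMap.comp_id, zero_sub] at this
    have hR : HasFDerivAt (fun x => ∑ ε : Fin g → ZMod 2,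
        chi (b ⬝ᵥ (ε + a)) * (kum τ (ε + a) (x + Z) * kum τ ε (x - Z))) _ 0 :=
      HasFDerivAt.fun_sum fun ε _ => ((h1 (ε + a)).fun_mul (h2 ε)).const_mul _
    have hE := (hL.congr_of_eventuallyEq (Filter.Eventually.of_forall fun x =>
      (th_mul_th hτ a b x Z).symm)).unique hR
    have h3 := congrArg (fun L => L u) hE
    have hu' := hu (a, b)
    rw [dth] at hu'
    have hn : ∀ ε, fderiv ℂ (kum τ ε) (-Z) u = -dkum τ u ε Z := fun ε => dkum_neg hτ u ε Z
    simp only [_root_.sum_apply, _root_.smul_apply, _root_.add_apply, smul_eq_mul, zero_add,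
      zero_sub, hu', mul_zero, hn, kum_neg] at h3
    rw [h3]
    refine Finset.sum_congr rfl fun ε _ => ?_
    rw [dkum, dkum]
    ring
  have hc : ∀ x : Fin g → ZMod 2, x + x = 0 := fun x => funext fun i => CharTwo.add_self_eq_zero _
  have h0 : ∑ b : Fin g → ZMod 2, chi (b ⬝ᵥ ε) * ∑ e : Fin g → ZMod 2,
      chi (b ⬝ᵥ (e + (ε' + ε))) * (dkum τ u (e + (ε' + ε)) Z * kum τ e Z -
        kum τ (e + (ε' + ε)) Z * dkum τ u e Z) = 0 :=
    Finset.sum_eq_zero fun b _ => by rw [key, mul_zero]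
  simp_rw [Finset.mul_sum] at h0
  rw [Finset.sum_comm] at h0
  simp_rw [← mul_assoc, ← Finset.sum_mul, sum_chi_dotProduct] at h0
  have hiff : ∀ e : Fin g → ZMod 2, ε = e + (ε' + ε) ↔ e = ε' := fun e => by
    constructor
    · intro h
      have h5 : e + ε' = 0 := by
        have h6 : e + (ε' + ε) + ε = ε + ε := by rw [← h]
        rwa [add_assoc, add_assoc, hc, add_zero] at h6
      calc e = e + ε' + ε' := by rw [add_assoc, hc, add_zero]
        _ = ε' := by rw [h5, zero_add]
    · rintro rfl
      rw [← add_assoc, hc, zero_add]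
  simp only [hiff, ite_mul, zero_mul, Finset.sum_ite_eq', Finset.mem_univ, if_true] at h0
  rw [← add_assoc, hc, zero_add] at h0
  have h7 := (mul_eq_zero.1 h0).resolve_left (pow_ne_zero _ two_ne_zero)
  linear_combination h7

theorem exists_kum_ne_zero {τ : Matrix (Fin g) (Fin g) ℂ} (hτ : IsSiegel τ)
    (h0 : th τ 0 0 ≠ 0) (Z : Fin g → ℂ) : ∃ ε, kum τ ε Z ≠ 0 := by
  by_contra! hk
  have hprod : ∀ s : ℂ, th τ 0 (s • Z) * th τ 0 ((1 - s) • Z) = 0 := fun s => by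
    have h := th_mul_th hτ 0 0 (s • Z) ((1 - s) • Z)
    have e : s • Z + (1 - s) • Z = Z := by rw [← add_smul]; simp
    simp only [e, hk, zero_mul, mul_zero, Finset.sum_const_zero] at h
    exact h
  have hf : Differentiable ℂ fun s : ℂ => th τ 0 (s • Z) :=
    (differentiable_th hτ 0).comp (differentiable_id.smul_const Z)
  have hf1 : Differentiable ℂ fun s : ℂ => th τ 0 ((1 - s) • Z) :=
    (differentiable_th hτ 0).comp ((differentiable_id.const_sub 1).smul_const Z)
  have hne : ∀ᶠ s in nhds (0 : ℂ), th τ 0 (s • Z) ≠ 0 :=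
    hf.continuous.continuousAt.eventually_ne (by simpa using h0)
  have hev : (fun s : ℂ => th τ 0 ((1 - s) • Z)) =ᶠ[nhds 0] fun _ => 0 :=
    hne.mono fun s hs => (mul_eq_zero.1 (hprod s)).resolve_left hs
  have han : AnalyticOnNhd ℂ (fun s : ℂ => th τ 0 ((1 - s) • Z)) Set.univ :=
    fun s _ => hf1.analyticAt s
  have h1 := congrFun (han.eq_of_eventuallyEq (fun _ _ => analyticAt_const) hev) 1
  simp only [sub_self, zero_smul] at h1
  exact h0 h1

end SecondOrder

section Lefschetz

variable {g : ℕ}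

theorem kum_add_int (τ : Matrix (Fin g) (Fin g) ℂ) (ε : Fin g → ZMod 2) (k : Fin g → ℤ)
    (Z : Fin g → ℂ) :
    kum τ ε (Z + ic k) = cexp (2 * Real.pi * I * (half (lift ε) ⬝ᵥ ic k)) * kum τ ε Z :=
  gtheta_add_int _ _ _ _

theorem kum_add_mulVec {τ : Matrix (Fin g) (Fin g) ℂ} (hτ : IsSiegel τ) (ε : Fin g → ZMod 2)
    (l : Fin g → ℤ) (Z : Fin g → ℂ) :
    kum τ ε (Z + ((2 : ℂ) • τ) *ᵥ ic l) =
      cexp (-(Real.pi * I * (ic l ⬝ᵥ ((2 : ℂ) • τ) *ᵥ ic l)) - 2 * Real.pi * I * (ic l ⬝ᵥ Z)) *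
        kum τ ε Z := by
  rw [kum, gtheta_add_mulVec (isSiegel_two_smul hτ).1, gtheta_add_int_char]
  rfl

theorem fderiv_comp_add {τ : Matrix (Fin g) (Fin g) ℂ} (hτ : IsSiegel τ) (ε : Fin g → ZMod 2)
    (w Z : Fin g → ℂ) :
    HasFDerivAt (fun x => kum τ ε (x + w)) (fderiv ℂ (kum τ ε) (Z + w)) Z := by
  have := (differentiable_kum hτ ε (Z + w)).hasFDerivAt.comp Z ((hasFDerivAt_id Z).add_const w)
  rwa [ContinuousLinearMap.comp_id] at this

theorem dkum_add_int {τ : Matrix (Fin g) (Fin g) ℂ} (hτ : IsSiegel τ) (u : Fin g → ℂ)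
    (ε : Fin g → ZMod 2) (k : Fin g → ℤ) (Z : Fin g → ℂ) :
    dkum τ u ε (Z + ic k) = cexp (2 * Real.pi * I * (half (lift ε) ⬝ᵥ ic k)) * dkum τ u ε Z := by
  have h1 := ((differentiable_kum hτ ε Z).hasFDerivAt.const_mul
    (cexp (2 * Real.pi * I * (half (lift ε) ⬝ᵥ ic k)))).congr_of_eventuallyEq
      (Filter.Eventually.of_forall fun x => kum_add_int τ ε k x)
  exact congrArg (fun L => L u) ((fderiv_comp_add hτ ε (ic k) Z).unique h1)

theorem dkum_add_mulVec {τ : Matrix (Fin g) (Fin g) ℂ} (hτ : IsSiegel τ) (u : Fin g → ℂ)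
    (ε : Fin g → ZMod 2) (l : Fin g → ℤ) (Z : Fin g → ℂ) :
    dkum τ u ε (Z + ((2 : ℂ) • τ) *ᵥ ic l) =
      cexp (-(Real.pi * I * (ic l ⬝ᵥ ((2 : ℂ) • τ) *ᵥ ic l)) - 2 * Real.pi * I * (ic l ⬝ᵥ Z)) *
        (dkum τ u ε Z - 2 * Real.pi * I * (ic l ⬝ᵥ u) * kum τ ε Z) := by
  set c : ℂ := -(Real.pi * I * (ic l ⬝ᵥ ((2 : ℂ) • τ) *ᵥ ic l)) with hc
  have h2 : HasFDerivAt (fun x : Fin g → ℂ => c - 2 * Real.pi * I * (ic l ⬝ᵥ x))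
      (-((2 * Real.pi * I : ℂ) • pairingCLM l)) Z := by
    have := (((pairingCLM l).hasFDerivAt (x := Z)).const_mul (2 * Real.pi * I : ℂ)).const_sub c
    refine this.congr_of_eventuallyEq (Filter.Eventually.of_forall fun x => ?_)
    simp only [pairingCLM_apply]
    rfl
  have h1 := (h2.cexp.fun_mul (differentiable_kum hτ ε Z).hasFDerivAt).congr_of_eventuallyEq
      (Filter.Eventually.of_forall fun x => kum_add_mulVec hτ ε l x)
  have h3 := congrArg (fun L => L u) ((fderiv_comp_add hτ ε (((2 : ℂ) • τ) *ᵥ ic l) Z).unique h1)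
  simp only [_root_.add_apply, _root_.smul_apply, _root_.neg_apply, smul_eq_mul,
    pairingCLM_apply] at h3
  rw [dkum, h3, dkum]
  have : pairing l u = ic l ⬝ᵥ u := rfl
  rw [this]
  ring

/-- The logarithmic derivative common to all second order theta functions. -/
theorem exists_log_deriv {τ : Matrix (Fin g) (Fin g) ℂ} (hτ : IsSiegel τ)
    (h0 : th τ 0 0 ≠ 0) {u : Fin g → ℂ} (hu : ∀ m, dth τ m u = 0) :
    ∃ κ : (Fin g → ℂ) → ℂ, Differentiable ℂ κ ∧ (∀ Z (k : Fin g → ℤ), κ (Z + ic k) = κ Z) ∧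
      ∀ Z (l : Fin g → ℤ),
        κ (Z + ((2 : ℂ) • τ) *ᵥ ic l) = κ Z - 2 * Real.pi * I * (ic l ⬝ᵥ u) := by
  choose e he using exists_kum_ne_zero hτ h0
  have hκ : ∀ Z ε, dkum τ u (e Z) Z / kum τ (e Z) Z * kum τ ε Z = dkum τ u ε Z := fun Z ε => by
    rw [div_mul_eq_mul_div, div_eq_iff (he Z), dkum_mul_kum hτ hu]
    ring
  set κ : (Fin g → ℂ) → ℂ := fun Z => dkum τ u (e Z) Z / kum τ (e Z) Z with hκdef
  have hκ : ∀ Z ε, κ Z * kum τ ε Z = dkum τ u ε Z := hκ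
  refine ⟨κ, fun Z => ?_, fun Z k => ?_, fun Z l => ?_⟩
  · have hd : DifferentiableAt ℂ (fun W => dkum τ u (e Z) W / kum τ (e Z) W) Z := by
      simp only [div_eq_mul_inv]
      exact (differentiable_dkum hτ u (e Z) Z).fun_mul ((differentiable_kum hτ (e Z) Z).fun_inv (he Z))
    refine hd.congr_of_eventuallyEq ?_
    filter_upwards [(differentiable_kum hτ (e Z)).continuous.continuousAt.eventually_ne (he Z)]
      with W hW
    rw [eq_div_iff hW, hκ]
  · have h1 := hκ (Z + ic k) (e Z)
    rw [kum_add_int, dkum_add_int hτ, ← hκ Z] at h1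
    refine mul_right_cancel₀ (mul_ne_zero (Complex.exp_ne_zero _) (he Z)) (h1.trans ?_)
    ring
  · have h1 := hκ (Z + ((2 : ℂ) • τ) *ᵥ ic l) (e Z)
    rw [kum_add_mulVec hτ, dkum_add_mulVec hτ, ← hκ Z] at h1
    refine mul_right_cancel₀ (mul_ne_zero (Complex.exp_ne_zero _) (he Z)) (h1.trans ?_)
    ring

theorem exists_real_coordinates {T : Matrix (Fin g) (Fin g) ℂ} (hT : IsSiegel T)
    (Z : Fin g → ℂ) : ∃ s r : Fin g → ℝ,
      Z = (fun i => (s i : ℂ)) + T *ᵥ fun i => (r i : ℂ) := by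
  set Y : Matrix (Fin g) (Fin g) ℝ := Matrix.of fun i j => (T i j).im with hY
  have hu : IsUnit Y.det := (hT.2.isUnit).map Matrix.detMonoidHom
  set r : Fin g → ℝ := Y⁻¹ *ᵥ fun i => (Z i).im with hr
  have hYr : Y *ᵥ r = fun i => (Z i).im := by
    rw [hr, mulVec_mulVec, Matrix.mul_nonsing_inv _ hu, one_mulVec]
  refine ⟨fun i => (Z i - (T *ᵥ fun i => (r i : ℂ)) i).re, r, ?_⟩
  funext i
  have him : ((T *ᵥ fun i => (r i : ℂ)) i).im = (Z i).im := by
    rw [← congrFun hYr i]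
    simp [mulVec, dotProduct, hY]
  apply Complex.ext
  · simp
  · simp [him]

/-- An entire function invariant under a full lattice is constant. -/
theorem eq_of_periodic {T : Matrix (Fin g) (Fin g) ℂ} (hT : IsSiegel T)
    {h : (Fin g → ℂ) → ℂ} (hd : Differentiable ℂ h)
    (h1 : ∀ Z (k : Fin g → ℤ), h (Z + ic k) = h Z)
    (h2 : ∀ Z (l : Fin g → ℤ), h (Z + T *ᵥ ic l) = h Z) (Z W : Fin g → ℂ) : h Z = h W := by
  refine hd.apply_eq_apply_of_bounded ?_ Z W
  set F : (Fin g → ℝ) × (Fin g → ℝ) → ℂ := fun p =>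
    h ((fun i => (p.1 i : ℂ)) + T *ᵥ fun i => (p.2 i : ℂ)) with hF
  have hFc : Continuous F := by
    refine hd.continuous.comp ?_
    refine Continuous.add (by fun_prop) ?_
    exact Continuous.matrix_mulVec continuous_const (by fun_prop)
  have hK : IsCompact (F '' (Set.Icc 0 1)) := isCompact_Icc.image hFc
  refine hK.isBounded.subset ?_
  rintro _ ⟨Z, rfl⟩
  obtain ⟨s, r, hsr⟩ := exists_real_coordinates hT Z
  refine ⟨(fun i => Int.fract (s i), fun i => Int.fract (r i)),
    ⟨⟨fun i => Int.fract_nonneg _, fun i => Int.fract_nonneg _⟩,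
      ⟨fun i => (Int.fract_lt_one _).le, fun i => (Int.fract_lt_one _).le⟩⟩, ?_⟩
  have e : Z = ((fun i => ((Int.fract (s i) : ℝ) : ℂ)) +
      T *ᵥ fun i => ((Int.fract (r i) : ℝ) : ℂ)) + ic (fun i => ⌊s i⌋) +
        T *ᵥ ic (fun i => ⌊r i⌋) := by
    have e1 : (fun i => (s i : ℂ)) =
        (fun i => ((Int.fract (s i) : ℝ) : ℂ)) + ic (fun i => ⌊s i⌋) := by
      funext i
      have := congrArg (fun x : ℝ => (x : ℂ)) (Int.fract_add_floor (s i)).symm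
      simp only [Complex.ofReal_add, Complex.ofReal_intCast] at this
      simpa only [ic, Pi.add_apply] using this
    have e2 : (fun i => (r i : ℂ)) =
        (fun i => ((Int.fract (r i) : ℝ) : ℂ)) + ic (fun i => ⌊r i⌋) := by
      funext i
      have := congrArg (fun x : ℝ => (x : ℂ)) (Int.fract_add_floor (r i)).symm
      simp only [Complex.ofReal_add, Complex.ofReal_intCast] at this
      simpa only [ic, Pi.add_apply] using this
    rw [hsr, e1, e2, mulVec_add]
    abel
  conv_rhs => rw [e, h2, h1]

/-- The gradients of the odd theta functions span the cotangent space when the theta constant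
with characteristic zero does not vanish. -/
theorem eq_zero_of_dth_eq_zero {τ : Matrix (Fin g) (Fin g) ℂ} (hτ : IsSiegel τ)
    (h0 : th τ 0 0 ≠ 0) {u : Fin g → ℂ} (hu : ∀ m, dth τ m u = 0) : u = 0 := by
  obtain ⟨κ, hd, h1, h2⟩ := exists_log_deriv hτ h0 hu
  have hadd : ∀ Z v, κ (Z + v) - κ Z = κ v - κ 0 := fun Z v => by
    have hdv : Differentiable ℂ fun W => κ (W + v) - κ W :=
      (hd.comp (differentiable_id.add_const v)).sub hd
    have := eq_of_periodic (isSiegel_two_smul hτ) hdv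
      (fun W k => by rw [add_right_comm, h1, h1])
      (fun W l => by rw [add_right_comm, h2, h2]; ring) Z 0
    simpa only [zero_add] using this
  set D := fderiv ℂ κ 0 with hD
  have hconst : ∀ Z, fderiv ℂ (fun W => κ W - D W) Z = 0 := fun Z => by
    have hs : HasFDerivAt (fun W => κ (W + Z)) (fderiv ℂ κ Z) 0 := by
      have h3 : HasFDerivAt κ (fderiv ℂ κ Z) (0 + Z) := by
        rw [zero_add]; exact (hd Z).hasFDerivAt
      have := h3.comp (0 : Fin g → ℂ) ((hasFDerivAt_id (0 : Fin g → ℂ)).add_const Z)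
      rwa [ContinuousLinearMap.comp_id] at this
    have hs2 : HasFDerivAt (fun W => κ (W + Z)) D 0 := by
      have := (hd 0).hasFDerivAt.add_const (κ Z - κ 0)
      refine this.congr_of_eventuallyEq (Filter.Eventually.of_forall fun W => ?_)
      have := hadd W Z
      simp only
      linear_combination this
    have := ((hd Z).hasFDerivAt.fun_sub D.hasFDerivAt).fderiv
    rw [this, hs.unique hs2, sub_self]
  have hlin : ∀ Z, κ Z = D Z + κ 0 := fun Z => by
    have := is_const_of_fderiv_eq_zero (hd.sub D.differentiable) hconst Z 0
    simp only [Pi.sub_apply, map_zero, sub_zero] at this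
    linear_combination this
  have hDe : ∀ k : Fin g → ℤ, D (ic k) = 0 := fun k => by
    have e1 := h1 0 k
    rw [zero_add, hlin (ic k)] at e1
    linear_combination e1
  have hD0 : D = 0 := by
    refine ContinuousLinearMap.coe_injective (LinearMap.pi_ext' fun i => ?_)
    ext
    have := hDe (Pi.single i 1)
    have e : ic (Pi.single i 1) = Pi.single i (1 : ℂ) := by
      funext j
      by_cases hj : j = i
      · subst hj; simp [ic]
      · simp [ic, hj]
    rw [e] at this
    simpa using this
  funext i
  have e1 := h2 0 (Pi.single i 1)
  rw [hlin, hD0, hlin 0, hD0] at e1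
  have e2 : ic (Pi.single i 1) ⬝ᵥ u = u i := by
    have e : ic (Pi.single i 1) = Pi.single i (1 : ℂ) := by
      funext j
      by_cases hj : j = i
      · subst hj; simp [ic]
      · simp [ic, hj]
    rw [e]
    simp
  rw [e2] at e1
  have e3 : 2 * (Real.pi : ℂ) * I * u i = 0 := by
    simp only [_root_.zero_apply] at e1
    linear_combination e1
  exact (mul_eq_zero.1 e3).resolve_left Complex.two_pi_I_ne_zero

end Lefschetz

section Vanishing

/-- Coordinates of `y i + y 6` for a frame `y`. -/
def frameCode (i : Fin 8) : Fin 6 → ZMod 2 :=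
  fun j => if i = 7 then 1 else if i.val = j.val then 1 else 0

theorem frameMap_frameCode {y : Fin 8 → ThetaChar 3} (hy : IsFrame y) (i : Fin 8) :
    frameMap y (frameCode i) = y i + y 6 := by
  fin_cases i
  · simp [frameMap, frameCode]
  · simp [frameMap, frameCode]
  · simp [frameMap, frameCode]
  · simp [frameMap, frameCode]
  · simp [frameMap, frameCode]
  · simp [frameMap, frameCode]
  · simp [frameMap, frameCode, char_add_self]
  · simp [frameMap, frameCode]
    have e2 : y 0 + y 6 + (y 1 + y 6) + (y 2 + y 6) + (y 3 + y 6) + (y 4 + y 6) + (y 5 + y 6) =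
        y 0 + y 1 + y 2 + y 3 + y 4 + y 5 + (y 6 + y 6) + ((y 6 + y 6) + (y 6 + y 6)) := by abel
    have e1 : y 0 + y 1 + y 2 + y 3 + y 4 + y 5 + y 6 + y 6 =
        y 0 + y 1 + y 2 + y 3 + y 4 + y 5 + (y 6 + y 6) := by abel
    rw [hy.apply_seven, e1, e2]
    simp only [char_add_self, add_zero]

theorem IsFrame.exists_add_eq_of_odd {y : Fin 8 → ThetaChar 3} (hy : IsFrame y) {m : ThetaChar 3}
    (hm : qform m = 1) : ∃ i j, i ≠ j ∧ m = y i + y j := by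
  obtain ⟨c, rfl⟩ := (frameMap_bijective hy).2 m
  have key : ∀ c : Fin 6 → ZMod 2, coordForm c = 1 → ∃ i j, i ≠ j ∧
      c = frameCode i + frameCode j := by
    unfold coordForm frameCode
    decide
  rw [qform_frameMap hy] at hm
  obtain ⟨i, j, hij, rfl⟩ := key c hm
  refine ⟨i, j, hij, ?_⟩
  rw [frameMap_add, frameMap_frameCode hy, frameMap_frameCode hy, add_add_add_comm, char_add_self,
    add_zero]

theorem IsFrame.exists_add_eq_of_even {y : Fin 8 → ThetaChar 3} (hy : IsFrame y)
    {m : ThetaChar 3} (hm : qform m = 0) :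
    m = 0 ∨ ∃ i j k, [0, i, j, k].Nodup ∧ m = y 0 + y i + y j + y k := by
  obtain ⟨c, rfl⟩ := (frameMap_bijective hy).2 m
  have key : ∀ c : Fin 6 → ZMod 2, coordForm c = 0 → c = 0 ∨ ∃ i j k : Fin 8,
      [0, i, j, k].Nodup ∧ c = frameCode 0 + frameCode i + frameCode j + frameCode k := by
    unfold coordForm frameCode
    decide +kernel
  rw [qform_frameMap hy] at hm
  rcases key c hm with rfl | ⟨i, j, k, hij, rfl⟩
  · left
    simp [frameMap]
  · refine Or.inr ⟨i, j, k, hij, ?_⟩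
    simp only [frameMap_add, frameMap_frameCode hy]
    have e : y 0 + y 6 + (y i + y 6) + (y j + y 6) + (y k + y 6) =
        y 0 + y i + y j + y k + ((y 6 + y 6) + (y 6 + y 6)) := by abel
    rw [e]
    simp only [char_add_self, add_zero]

theorem IsFrame.qform_four {y : Fin 8 → ThetaChar 3} (hy : IsFrame y) {i j k l : Fin 8}
    (h : [i, j, k, l].Nodup) : qform (y i + y j + y k + y l) = 0 := by
  simp only [List.nodup_cons, List.mem_cons, List.not_mem_nil, or_false, not_or, not_false_eq_true,
    List.nodup_nil, and_true] at h
  obtain ⟨⟨hij, hik, hil⟩, ⟨hjk, hjl⟩, hkl⟩ := h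
  have e : y i + y j + y k + y l = (y i + y j) + (y k + y l) := by abel
  have h1 := hy.1 i j hij
  have h2 := hy.1 k l hkl
  have h3 := hy.1 i k hik
  have h4 := hy.1 i l hil
  have h5 := hy.1 j k hjk
  have h6 := hy.1 j l hjl
  rw [e, qform_add, h1, h2, sform_add_left, sform_add_right, sform_add_right]
  rw [qform_add] at h1 h2 h3 h4 h5 h6
  generalize qform (y i) = a at *
  generalize qform (y j) = b at *
  generalize qform (y k) = c at *
  generalize qform (y l) = d at *
  generalize sform (y i) (y k) = p at *
  generalize sform (y i) (y l) = q at *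
  generalize sform (y j) (y k) = r at *
  generalize sform (y j) (y l) = t at *
  have hp : p = 1 + a + c := by rw [← h3]; ring_nf; simp [CharTwo.two_eq_zero]
  have hq : q = 1 + a + d := by rw [← h4]; ring_nf; simp [CharTwo.two_eq_zero]
  have hr : r = 1 + b + c := by rw [← h5]; ring_nf; simp [CharTwo.two_eq_zero]
  have ht : t = 1 + b + d := by rw [← h6]; ring_nf; simp [CharTwo.two_eq_zero]
  rw [hp, hq, hr, ht]
  clear h1 h2 h3 h4 h5 h6 hp hq hr ht
  revert a b c d
  decide

theorem qform_zero : qform (0 : ThetaChar 3) = 0 := by simp [qform]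

theorem star_char_add (y : Fin 8 → ThetaChar 3) (x : Fin 8) :
    y 0 + y x + (y 5 + y 6) = y 0 + y x + y 5 + y 6 ∧
    y 0 + y x + (y 5 + y 7) = y 0 + y x + y 5 + y 7 ∧
    y 0 + y x + (y 5 + y 6 + (y 5 + y 7)) = y 0 + y x + y 6 + y 7 := by
  refine ⟨by abel, by abel, ?_⟩
  have e : y 0 + y x + (y 5 + y 6 + (y 5 + y 7)) = y 0 + y x + y 6 + y 7 + (y 5 + y 5) := by abel
  rw [e, char_add_self, add_zero]

theorem star_thprod (τ : Matrix (Fin 3) (Fin 3) ℂ) (y : Fin 8 → ThetaChar 3) (x : Fin 8) :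
    thprod τ (y 5 + y 6) (y 5 + y 7) (y 0 + y x) = th τ (y 0 + y x + y 5 + y 6) 0 *
      th τ (y 0 + y x + y 5 + y 7) 0 * th τ (y 0 + y x + y 6 + y 7) 0 := by
  obtain ⟨h1, h2, h3⟩ := star_char_add y x
  rw [thprod, h1, h2, h3]

theorem edge_thprod_star (τ : Matrix (Fin 3) (Fin 3) ℂ) (y : Fin 8 → ThetaChar 3) (x : Fin 8) :
    thprod τ (y 4 + y 5) (y 0 + y 4 + y 6 + y 7) (y 0 + y x) = th τ (y 0 + y x + y 4 + y 5) 0 *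
      th τ (y x + y 4 + y 6 + y 7) 0 * th τ (y x + y 5 + y 6 + y 7) 0 := by
  have e1 : y 0 + y x + (y 4 + y 5) = y 0 + y x + y 4 + y 5 := by abel
  have e2 : y 0 + y x + (y 0 + y 4 + y 6 + y 7) = y x + y 4 + y 6 + y 7 + (y 0 + y 0) := by abel
  have e3 : y 0 + y x + (y 4 + y 5 + (y 0 + y 4 + y 6 + y 7)) =
      y x + y 5 + y 6 + y 7 + ((y 0 + y 0) + (y 4 + y 4)) := by abel
  rw [thprod, e1, e2, e3]
  simp only [char_add_self, add_zero]

theorem edge_thprod (τ : Matrix (Fin 3) (Fin 3) ℂ) (y : Fin 8 → ThetaChar 3) :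
    thprod τ (y 4 + y 5) (y 0 + y 4 + y 6 + y 7) (y 4 + y 5) = th τ 0 0 *
      th τ (y 0 + y 5 + y 6 + y 7) 0 * th τ (y 0 + y 4 + y 6 + y 7) 0 := by
  have e1 : y 4 + y 5 + (y 4 + y 5) = 0 := char_add_self _
  have e2 : y 4 + y 5 + (y 0 + y 4 + y 6 + y 7) = y 0 + y 5 + y 6 + y 7 + (y 4 + y 4) := by abel
  have e3 : y 4 + y 5 + (y 4 + y 5 + (y 0 + y 4 + y 6 + y 7)) =
      y 0 + y 4 + y 6 + y 7 + ((y 4 + y 4) + (y 5 + y 5)) := by abel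
  rw [thprod, e1, e3, e2]
  simp only [char_add_self, add_zero]

/-- The three vanishing gradients at a vertex force a fourth one to vanish. -/
theorem IsFrame.dth_star {y : Fin 8 → ThetaChar 3} (hy : IsFrame y)
    {τ : Matrix (Fin 3) (Fin 3) ℂ} (hτ : IsSiegel τ) (hev : ∀ m, qform m = 0 → th τ m 0 ≠ 0)
    {u : Fin 3 → ℂ} (h1 : dth τ (y 0 + y 1) u = 0) (h2 : dth τ (y 0 + y 2) u = 0)
    (h3 : dth τ (y 0 + y 3) u = 0) : dth τ (y 0 + y 4) u = 0 := by
  obtain ⟨ε, hε⟩ := exists_star_relation hy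
  have h := hε τ hτ u
  simp only [Fin.sum_univ_four, Matrix.cons_val, h1, h2, h3, mul_zero, zero_add] at h
  refine (mul_eq_zero.1 h).resolve_left (mul_ne_zero (chi_ne_zero _) ?_)
  rw [star_thprod]
  exact mul_ne_zero (mul_ne_zero (hev _ (hy.qform_four (by decide)))
    (hev _ (hy.qform_four (by decide)))) (hev _ (hy.qform_four (by decide)))

theorem IsFrame.dth_edge {y : Fin 8 → ThetaChar 3} (hy : IsFrame y)
    {τ : Matrix (Fin 3) (Fin 3) ℂ} (hτ : IsSiegel τ) (hev : ∀ m, qform m = 0 → th τ m 0 ≠ 0)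
    {u : Fin 3 → ℂ} (h1 : dth τ (y 0 + y 1) u = 0) (h2 : dth τ (y 0 + y 2) u = 0)
    (h3 : dth τ (y 0 + y 3) u = 0) : dth τ (y 4 + y 5) u = 0 := by
  obtain ⟨ε, hε⟩ := exists_edge_relation hy
  have h := hε τ hτ u
  simp only [Fin.sum_univ_four, Matrix.cons_val, h1, h2, h3, mul_zero, zero_add] at h
  refine (mul_eq_zero.1 h).resolve_left (mul_ne_zero (chi_ne_zero _) ?_)
  rw [edge_thprod]
  exact mul_ne_zero (mul_ne_zero (hev _ qform_zero)
    (hev _ (hy.qform_four (by decide)))) (hev _ (hy.qform_four (by decide)))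

theorem exists_perm_of_ne {i j : Fin 8} (hi : i ≠ 0) (hj : j ≠ 0) (hij : i ≠ j) :
    ∃ σ : Equiv.Perm (Fin 8), σ 0 = 0 ∧ σ 4 = i ∧ σ 5 = j := by
  obtain ⟨σ, hσ⟩ := Equiv.Perm.exists_extending_pair (![0, 4, 5] : Fin 3 → Fin 8) ![0, i, j]
    (by decide) (by
      rw [← List.nodup_ofFn]
      simp [hi.symm, hj.symm, hij])
  exact ⟨σ, hσ 0, hσ 1, hσ 2⟩

/-- Three gradients at a vertex of a frame are linearly independent. -/
theorem IsFrame.eq_zero_of_dth {y : Fin 8 → ThetaChar 3} (hy : IsFrame y)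
    {τ : Matrix (Fin 3) (Fin 3) ℂ} (hτ : IsSiegel τ) (hev : ∀ m, qform m = 0 → th τ m 0 ≠ 0)
    {u : Fin 3 → ℂ} (h1 : dth τ (y 0 + y 1) u = 0) (h2 : dth τ (y 0 + y 2) u = 0)
    (h3 : dth τ (y 0 + y 3) u = 0) : u = 0 := by
  have hstar : ∀ x : Fin 8, x ≠ 0 → dth τ (y 0 + y x) u = 0 := fun x hx => by
    by_cases hx1 : x = 1
    · rwa [hx1]
    by_cases hx2 : x = 2
    · rwa [hx2]
    by_cases hx3 : x = 3
    · rwa [hx3]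
    have e : ∀ k : Fin 8, k ≠ 4 → k ≠ x → Equiv.swap 4 x k = k := fun k h h' =>
      Equiv.swap_apply_of_ne_of_ne h h'
    have e0 := e 0 (by decide) (Ne.symm hx)
    have e1 := e 1 (by decide) (Ne.symm hx1)
    have e2 := e 2 (by decide) (Ne.symm hx2)
    have e3 := e 3 (by decide) (Ne.symm hx3)
    have h := (hy.comp (Equiv.swap 4 x)).dth_star hτ hev (u := u)
    simp only [e0, e1, e2, e3, Equiv.swap_apply_left] at h
    exact h h1 h2 h3
  refine eq_zero_of_dth_eq_zero hτ (hev 0 qform_zero) fun m => ?_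
  rcases qform_eq_zero_or_one m with hm | hm
  · exact dth_of_even hτ hm u
  obtain ⟨i, j, hij, rfl⟩ := hy.exists_add_eq_of_odd hm
  by_cases hi : i = 0
  · subst hi
    exact hstar j hij.symm
  by_cases hj : j = 0
  · subst hj
    rw [add_comm]
    exact hstar i hij
  obtain ⟨σ, s0, s4, s5⟩ := exists_perm_of_ne hi hj hij
  have h := (hy.comp σ).dth_edge hτ hev (u := u)
  simp only [s0, s4, s5] at h
  have hσ : ∀ k : Fin 8, k ≠ 0 → σ k ≠ 0 := fun k hk => by
    rw [← s0]; exact σ.injective.ne hk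
  exact h (hstar _ (hσ 1 (by decide))) (hstar _ (hσ 2 (by decide))) (hstar _ (hσ 3 (by decide)))

end Vanishing

section Ratios

theorem exists_ne_zero_of_two (f g : (Fin 3 → ℂ) →L[ℂ] ℂ) : ∃ u ≠ 0, f u = 0 ∧ g u = 0 := by
  have h : LinearMap.ker ((f : (Fin 3 → ℂ) →ₗ[ℂ] ℂ).prod (g : (Fin 3 → ℂ) →ₗ[ℂ] ℂ)) ≠ ⊥ :=
    LinearMap.ker_ne_bot_of_finrank_lt (by simp)
  obtain ⟨u, hu, hu0⟩ := Submodule.exists_mem_ne_zero_of_ne_bot h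
  rw [LinearMap.mem_ker, LinearMap.prod_apply] at hu
  exact ⟨u, hu0, congrArg Prod.fst hu, congrArg Prod.snd hu⟩

/-- The relations between ratios `R` of even theta constants and ratios `L` of odd gradients that
follow from the linear relations among odd gradients. -/
structure IsRatioSystem (R L : ThetaChar 3 → ℂ) : Prop where
  even_ne_zero : ∀ m, qform m = 0 → R m ≠ 0
  odd_ne_zero : ∀ m, qform m = 1 → L m ≠ 0
  star : ∀ y, IsFrame y →
    R (y 0 + y 1 + y 5 + y 6) * R (y 0 + y 1 + y 5 + y 7) * R (y 0 + y 1 + y 6 + y 7) *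
        L (y 0 + y 1) =
      R (y 0 + y 2 + y 5 + y 6) * R (y 0 + y 2 + y 5 + y 7) * R (y 0 + y 2 + y 6 + y 7) *
        L (y 0 + y 2)
  edge : ∀ y, IsFrame y →
    R (y 0 + y 3 + y 4 + y 5) * R (y 3 + y 4 + y 6 + y 7) * R (y 3 + y 5 + y 6 + y 7) *
        L (y 0 + y 3) =
      R 0 * R (y 0 + y 5 + y 6 + y 7) * R (y 0 + y 4 + y 6 + y 7) * L (y 4 + y 5)

theorem ratio_eq_of_relations {p q r s : ℂ} {a b : ℂ} (hp : p ≠ 0) (hh : p + q = 0)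
    (h : p * a + q * b = 0) (hr : r = a) (hs : s = b) : r = s := by
  have hq : q = -p := by linear_combination hh
  rw [hr, hs]
  apply mul_left_cancel₀ hp
  rw [hq] at h
  linear_combination h

theorem isRatioSystem_of_proportional {τ τ' : Matrix (Fin 3) (Fin 3) ℂ} (hτ : IsSiegel τ)
    (hτ' : IsSiegel τ') (hev : ∀ m, qform m = 0 → th τ m 0 ≠ 0)
    (hev' : ∀ m, qform m = 0 → th τ' m 0 ≠ 0) {L : ThetaChar 3 → ℂ}
    (hL : ∀ m, qform m = 1 → L m ≠ 0)
    (hd : ∀ m, qform m = 1 → ∀ u, dth τ' m u = L m * dth τ m u) :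
    IsRatioSystem (fun m => th τ' m 0 / th τ m 0) L := by
  set R : ThetaChar 3 → ℂ := fun m => th τ' m 0 / th τ m 0 with hRdef
  have hR : ∀ m, qform m = 0 → th τ' m 0 = R m * th τ m 0 := fun m hm => by
    rw [hRdef]
    exact (div_mul_cancel₀ _ (hev m hm)).symm
  refine ⟨fun m hm => div_ne_zero (hev' m hm) (hev m hm), hL, fun y hy => ?_, fun y hy => ?_⟩
  · obtain ⟨ε, hε⟩ := exists_star_relation hy
    obtain ⟨u, hu0, hu3, hu4⟩ := exists_ne_zero_of_two (fderiv ℂ (th τ (y 0 + y 3)) 0)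
      (fderiv ℂ (th τ (y 0 + y 4)) 0)
    change dth τ (y 0 + y 3) u = 0 at hu3
    change dth τ (y 0 + y 4) u = 0 at hu4
    have h := hε τ hτ u
    have h' := hε τ' hτ' u
    have hd1 : dth τ (y 0 + y 1) u ≠ 0 := fun h1 => by
      refine hu0 ((hy.comp (Equiv.swap 2 4)).eq_zero_of_dth hτ hev ?_ ?_ ?_)
      · exact h1
      · exact hu4
      · exact hu3
    simp only [Fin.sum_univ_four, Matrix.cons_val, hu3, hu4, mul_zero, add_zero, star_thprod,
      hd _ (hy.1 0 1 (by decide)), hd _ (hy.1 0 2 (by decide)), hd _ (hy.1 0 3 (by decide)),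
      hd _ (hy.1 0 4 (by decide)), hR _ (hy.qform_four (i := 0) (j := 1) (k := 5) (l := 6)
        (by decide)), hR _ (hy.qform_four (i := 0) (j := 1) (k := 5) (l := 7) (by decide)),
      hR _ (hy.qform_four (i := 0) (j := 1) (k := 6) (l := 7) (by decide)),
      hR _ (hy.qform_four (i := 0) (j := 2) (k := 5) (l := 6) (by decide)),
      hR _ (hy.qform_four (i := 0) (j := 2) (k := 5) (l := 7) (by decide)),
      hR _ (hy.qform_four (i := 0) (j := 2) (k := 6) (l := 7) (by decide))] at h h'
    refine ratio_eq_of_relations (mul_ne_zero (mul_ne_zero (chi_ne_zero _) (mul_ne_zero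
      (mul_ne_zero (hev _ (hy.qform_four (by decide))) (hev _ (hy.qform_four (by decide))))
      (hev _ (hy.qform_four (by decide))))) hd1) h ?_ rfl rfl
    linear_combination h'
  · obtain ⟨ε, hε⟩ := exists_edge_relation hy
    obtain ⟨u, hu0, hu1, hu2⟩ := exists_ne_zero_of_two (fderiv ℂ (th τ (y 0 + y 1)) 0)
      (fderiv ℂ (th τ (y 0 + y 2)) 0)
    change dth τ (y 0 + y 1) u = 0 at hu1
    change dth τ (y 0 + y 2) u = 0 at hu2
    have h := hε τ hτ u
    have h' := hε τ' hτ' u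
    have hd3 : dth τ (y 0 + y 3) u ≠ 0 := fun h3 => hu0 (hy.eq_zero_of_dth hτ hev hu1 hu2 h3)
    simp only [Fin.sum_univ_four, Matrix.cons_val, hu1, hu2, mul_zero, zero_add, edge_thprod_star,
      edge_thprod, hd _ (hy.1 0 1 (by decide)), hd _ (hy.1 0 2 (by decide)),
      hd _ (hy.1 0 3 (by decide)), hd _ (hy.1 4 5 (by decide)), hR 0 qform_zero,
      hR _ (hy.qform_four (i := 0) (j := 3) (k := 4) (l := 5) (by decide)),
      hR _ (hy.qform_four (i := 3) (j := 4) (k := 6) (l := 7) (by decide)),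
      hR _ (hy.qform_four (i := 3) (j := 5) (k := 6) (l := 7) (by decide)),
      hR _ (hy.qform_four (i := 0) (j := 5) (k := 6) (l := 7) (by decide)),
      hR _ (hy.qform_four (i := 0) (j := 4) (k := 6) (l := 7) (by decide))] at h h'
    refine ratio_eq_of_relations (mul_ne_zero (mul_ne_zero (chi_ne_zero _) (mul_ne_zero
      (mul_ne_zero (hev _ (hy.qform_four (by decide))) (hev _ (hy.qform_four (by decide))))
      (hev _ (hy.qform_four (by decide))))) hd3) h ?_ rfl rfl
    linear_combination h'

end Ratios

section Combinatorics

theorem IsFrame.four_eq_four {y : Fin 8 → ThetaChar 3} (hy : IsFrame y) (σ : Equiv.Perm (Fin 8)) :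
    y (σ 0) + y (σ 1) + y (σ 2) + y (σ 3) = y (σ 4) + y (σ 5) + y (σ 6) + y (σ 7) := by
  have h := (hy.comp σ).2
  rw [Fin.sum_univ_eight] at h
  have e : y (σ 0) + y (σ 1) + y (σ 2) + y (σ 3) + y (σ 4) + y (σ 5) + y (σ 6) + y (σ 7) =
      (y (σ 0) + y (σ 1) + y (σ 2) + y (σ 3)) +
        (y (σ 4) + y (σ 5) + y (σ 6) + y (σ 7)) := by abel
  rw [e] at h
  rw [eq_neg_of_add_eq_zero_left h]
  exact neg_eq_of_add_eq_zero_left (char_add_self _)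

theorem IsFrame.four_compl {y : Fin 8 → ThetaChar 3} (hy : IsFrame y) {a b c d i j k l : Fin 8}
    (h : [a, b, c, d, i, j, k, l].Nodup) : y a + y b + y c + y d = y i + y j + y k + y l := by
  obtain ⟨σ, hσ⟩ := Equiv.Perm.exists_extending_pair (id : Fin 8 → Fin 8) ![a, b, c, d, i, j, k, l]
    Function.injective_id (by rw [← List.nodup_ofFn]; simpa using h)
  have e := hy.four_eq_four σ
  have h0 := hσ 0
  have h1 := hσ 1
  have h2 := hσ 2
  have h3 := hσ 3
  have h4 := hσ 4
  have h5 := hσ 5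
  have h6 := hσ 6
  have h7 := hσ 7
  simp only [id, Matrix.cons_val] at h0 h1 h2 h3 h4 h5 h6 h7
  rwa [h0, h1, h2, h3, h4, h5, h6, h7] at e

variable {R L : ThetaChar 3 → ℂ} {y : Fin 8 → ThetaChar 3}

theorem IsRatioSystem.star_of_nodup (hR : IsRatioSystem R L) (hy : IsFrame y)
    {v x z e f g : Fin 8} (h : [v, x, z, e, f, g].Nodup) :
    R (y v + y x + y e + y f) * R (y v + y x + y e + y g) * R (y v + y x + y f + y g) *
        L (y v + y x) =
      R (y v + y z + y e + y f) * R (y v + y z + y e + y g) * R (y v + y z + y f + y g) *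
        L (y v + y z) := by
  obtain ⟨σ, hσ⟩ := Equiv.Perm.exists_extending_pair (![0, 1, 2, 5, 6, 7] : Fin 6 → Fin 8)
    ![v, x, z, e, f, g] (by decide) (by rw [← List.nodup_ofFn]; simpa using h)
  have h0 := hσ 0
  have h1 := hσ 1
  have h2 := hσ 2
  have h3 := hσ 3
  have h4 := hσ 4
  have h5 := hσ 5
  simp only [Matrix.cons_val] at h0 h1 h2 h3 h4 h5
  have e := hR.star _ (hy.comp σ)
  simp only [h0, h1, h2, h3, h4, h5] at e
  exact e

theorem sq_eq_of_triangles {a₁ a₂ a₃ a₄ a₅ a₆ c : ℂ} (hc : c ≠ 0) (h1 : a₁ * a₂ * a₃ = c)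
    (h2 : a₁ * a₄ * a₅ = c) (h3 : a₂ * a₄ * a₆ = c) (h4 : a₃ * a₅ * a₆ = c) :
    a₂ ^ 2 = a₅ ^ 2 := by
  have n1 : a₁ ≠ 0 := by rintro rfl; apply hc; rw [← h1]; ring
  have n3 : a₃ ≠ 0 := by rintro rfl; apply hc; rw [← h1]; ring
  have n6 : a₆ ≠ 0 := by rintro rfl; apply hc; rw [← h3]; ring
  have n4 : a₄ ≠ 0 := by rintro rfl; apply hc; rw [← h3]; ring
  have e1 : a₂ * a₃ = a₄ * a₅ := mul_left_cancel₀ n1 (by linear_combination h1 - h2)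
  have e2 : a₂ * a₄ = a₃ * a₅ := mul_right_cancel₀ n6 (by linear_combination h3 - h4)
  apply mul_left_cancel₀ (mul_ne_zero n3 n4)
  linear_combination a₂ * a₄ * e1 + a₄ * a₅ * e2

/-- The ratio of `R` at the four-element sets `v, x, e, f` and `v, z, e, f`. -/
def edgeRatio (R : ThetaChar 3 → ℂ) (y : Fin 8 → ThetaChar 3) (v x z e f : Fin 8) : ℂ :=
  R (y v + y x + y e + y f) / R (y v + y z + y e + y f)

theorem IsRatioSystem.triangle (hR : IsRatioSystem R L) (hy : IsFrame y)
    {v x z e f g : Fin 8} (h : [v, x, z, e, f, g].Nodup) :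
    edgeRatio R y v x z e f * edgeRatio R y v x z e g * edgeRatio R y v x z f g =
      L (y v + y z) / L (y v + y x) := by
  have key := hR.star_of_nodup hy h
  have hne : ∀ i j k l : Fin 8, [i, j, k, l].Nodup → R (y i + y j + y k + y l) ≠ 0 :=
    fun i j k l h => hR.even_ne_zero _ (hy.qform_four h)
  have n1 := hne v z e f (by clear key; simp at h ⊢; tauto)
  have n2 := hne v z e g (by clear key; simp at h ⊢; tauto)
  have n3 := hne v z f g (by clear key; simp at h ⊢; tauto)
  have n4 := hR.odd_ne_zero _ (hy.1 v x (by clear key; simp at h ⊢; tauto))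
  unfold edgeRatio
  rw [div_mul_div_comm, div_mul_div_comm, div_eq_div_iff (mul_ne_zero (mul_ne_zero n1 n2) n3) n4,
    key]
  ring

theorem IsRatioSystem.edgeRatio_sq (hR : IsRatioSystem R L) (hy : IsFrame y)
    {v x z e f g h : Fin 8} (hn : [v, x, z, e, f, g, h].Nodup) :
    edgeRatio R y v x z e g ^ 2 = edgeRatio R y v x z f h ^ 2 := by
  have n1 := hR.odd_ne_zero _ (hy.1 v x (by simp at hn ⊢; tauto))
  have n2 := hR.odd_ne_zero _ (hy.1 v z (by simp at hn ⊢; tauto))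
  exact sq_eq_of_triangles (div_ne_zero n2 n1)
    (hR.triangle hy (e := e) (f := f) (g := g) (by simp at hn ⊢; tauto))
    (hR.triangle hy (e := e) (f := f) (g := h) (by simp at hn ⊢; tauto))
    (hR.triangle hy (e := e) (f := g) (g := h) (by simp at hn ⊢; tauto))
    (hR.triangle hy (e := f) (f := g) (g := h) (by simp at hn ⊢; tauto))

theorem edgeRatio_compl (hy : IsFrame y) {v x z e f g h k : Fin 8}
    (hn : [v, x, z, e, f, g, h, k].Nodup) :
    edgeRatio R y v x z e f = (edgeRatio R y g x z h k)⁻¹ := by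
  rw [edgeRatio, edgeRatio, inv_div]
  have e1 : y v + y x + y e + y f = y g + y z + y h + y k :=
    hy.four_compl (by simp at hn ⊢; tauto)
  have e2 : y v + y z + y e + y f = y g + y x + y h + y k :=
    hy.four_compl (by simp at hn ⊢; tauto)
  rw [e1, e2]

theorem IsRatioSystem.pow_four_eq_aux (hR : IsRatioSystem R L) (hy : IsFrame y) :
    R (y 0 + y 1 + y 3 + y 4) ^ 4 = R (y 0 + y 2 + y 3 + y 4) ^ 4 := by
  have hne : ∀ i j k l : Fin 8, [i, j, k, l].Nodup → R (y i + y j + y k + y l) ≠ 0 :=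
    fun i j k l h => hR.even_ne_zero _ (hy.qform_four h)
  have n1 := hne 0 1 3 4 (by decide)
  have n2 := hne 0 2 3 4 (by decide)
  have h1 : edgeRatio R y 0 1 2 3 4 ^ 2 = (edgeRatio R y 0 1 2 3 4 ^ 2)⁻¹ := by
    calc edgeRatio R y 0 1 2 3 4 ^ 2 = (edgeRatio R y 5 1 2 6 7 ^ 2)⁻¹ := by
          rw [edgeRatio_compl hy (g := 5) (h := 6) (k := 7) (by decide), inv_pow]
      _ = (edgeRatio R y 5 1 2 3 4 ^ 2)⁻¹ := by
          rw [hR.edgeRatio_sq hy (e := 6) (f := 3) (g := 7) (h := 4) (by decide)]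
      _ = edgeRatio R y 6 1 2 0 7 ^ 2 := by
          rw [edgeRatio_compl hy (g := 6) (h := 0) (k := 7) (by decide), inv_pow, inv_inv]
      _ = edgeRatio R y 6 1 2 3 4 ^ 2 := hR.edgeRatio_sq hy (by decide)
      _ = (edgeRatio R y 0 1 2 5 7 ^ 2)⁻¹ := by
          rw [edgeRatio_compl hy (g := 0) (h := 5) (k := 7) (by decide), inv_pow]
      _ = (edgeRatio R y 0 1 2 3 4 ^ 2)⁻¹ := by
          rw [hR.edgeRatio_sq hy (e := 5) (f := 3) (g := 7) (h := 4) (by decide)]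
  have h2 : edgeRatio R y 0 1 2 3 4 ^ 4 = 1 := by
    have h3 : edgeRatio R y 0 1 2 3 4 ^ 2 ≠ 0 := pow_ne_zero _ (div_ne_zero n1 n2)
    have h4 : edgeRatio R y 0 1 2 3 4 ^ 4 =
      edgeRatio R y 0 1 2 3 4 ^ 2 * edgeRatio R y 0 1 2 3 4 ^ 2 := by ring
    rw [h4]
    nth_rewrite 2 [h1]
    exact mul_inv_cancel₀ h3
  rwa [edgeRatio, div_pow, div_eq_one_iff_eq (pow_ne_zero _ n2)] at h2

theorem IsRatioSystem.pow_four_eq_of_nodup (hR : IsRatioSystem R L) (hy : IsFrame y)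
    {v x z e f : Fin 8} (h : [v, x, z, e, f].Nodup) :
    R (y v + y x + y e + y f) ^ 4 = R (y v + y z + y e + y f) ^ 4 := by
  obtain ⟨σ, hσ⟩ := Equiv.Perm.exists_extending_pair (![0, 1, 2, 3, 4] : Fin 5 → Fin 8)
    ![v, x, z, e, f] (by decide) (by rw [← List.nodup_ofFn]; simpa using h)
  have h0 := hσ 0
  have h1 := hσ 1
  have h2 := hσ 2
  have h3 := hσ 3
  have h4 := hσ 4
  simp only [Matrix.cons_val] at h0 h1 h2 h3 h4
  have e := hR.pow_four_eq_aux (hy.comp σ)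
  simp only [h0, h1, h2, h3, h4] at e
  exact e

theorem IsRatioSystem.pow_four_eq (hR : IsRatioSystem R L) (hy : IsFrame y) {i j k : Fin 8}
    (h : [0, i, j, k].Nodup) :
    R (y 0 + y i + y j + y k) ^ 4 = R (y 0 + y 1 + y 2 + y 3) ^ 4 := by
  have swap1 : ∀ a b c : Fin 8, y 0 + y a + y b + y c = y 0 + y b + y a + y c :=
    fun a b c => by abel
  have swap2 : ∀ a b c : Fin 8, y 0 + y a + y b + y c = y 0 + y c + y b + y a :=
    fun a b c => by abel
  have hrep : ∀ a b c d : Fin 8, [0, a, b, c].Nodup → [0, d, b, c].Nodup →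
      R (y 0 + y a + y b + y c) ^ 4 = R (y 0 + y d + y b + y c) ^ 4 := fun a b c d h1 h2 => by
    by_cases hd : a = d
    · rw [hd]
    · exact hR.pow_four_eq_of_nodup hy (by simp at h1 h2 ⊢; tauto)
  have three : ∀ c : Fin 8, [0, 1, 2, c].Nodup →
      R (y 0 + y 1 + y 2 + y c) ^ 4 = R (y 0 + y 1 + y 2 + y 3) ^ 4 := fun c hc => by
    rw [swap2 1 2 c, swap2 1 2 3]
    exact hrep _ _ _ _ (by simp at hc ⊢; tauto) (by decide)
  have two : ∀ b c : Fin 8, [0, 1, b, c].Nodup →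
      R (y 0 + y 1 + y b + y c) ^ 4 = R (y 0 + y 1 + y 2 + y 3) ^ 4 := fun b c hc => by
    by_cases hc2 : c = 2
    · subst hc2
      rw [add_right_comm]
      exact three b (by simp at hc ⊢; tauto)
    · rw [swap1 1 b c, hrep b 1 c 2 (by simp at hc ⊢; tauto) (by simp at hc ⊢; tauto), swap1 2 1]
      exact three c (by simp at hc ⊢; tauto)
  by_cases hj : j = 1
  · subst hj
    rw [swap1]
    exact two i k (by simp at h ⊢; tauto)
  by_cases hk : k = 1
  · subst hk
    rw [swap2]
    exact two j i (by simp at h ⊢; tauto)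
  · rw [hrep i j k 1 h (by simp at h ⊢; tauto)]
    exact two j k (by simp at h ⊢; tauto)

theorem IsRatioSystem.odd_pow_four_eq (hR : IsRatioSystem R L) (hy : IsFrame y) :
    L (y 0 + y 1) ^ 4 = L (y 0 + y 2) ^ 4 := by
  have hne : R (y 0 + y 1 + y 2 + y 3) ≠ 0 := hR.even_ne_zero _ (hy.qform_four (by decide))
  have h := congrArg (· ^ 4) (hR.star y hy)
  simp only [mul_pow] at h
  rw [hR.pow_four_eq hy (i := 1) (j := 5) (k := 6) (by decide),
    hR.pow_four_eq hy (i := 1) (j := 5) (k := 7) (by decide),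
    hR.pow_four_eq hy (i := 1) (j := 6) (k := 7) (by decide),
    hR.pow_four_eq hy (i := 2) (j := 5) (k := 6) (by decide),
    hR.pow_four_eq hy (i := 2) (j := 5) (k := 7) (by decide),
    hR.pow_four_eq hy (i := 2) (j := 6) (k := 7) (by decide)] at h
  have hne4 := pow_ne_zero 4 hne
  exact mul_left_cancel₀ (mul_ne_zero (mul_ne_zero hne4 hne4) hne4) h

theorem IsRatioSystem.odd_pow_four_eq_of_nodup (hR : IsRatioSystem R L) (hy : IsFrame y)
    {v x z : Fin 8} (h : [v, x, z].Nodup) : L (y v + y x) ^ 4 = L (y v + y z) ^ 4 := by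
  obtain ⟨σ, hσ⟩ := Equiv.Perm.exists_extending_pair (![0, 1, 2] : Fin 3 → Fin 8)
    ![v, x, z] (by decide) (by rw [← List.nodup_ofFn]; simpa using h)
  have h0 := hσ 0
  have h1 := hσ 1
  have h2 := hσ 2
  simp only [Matrix.cons_val] at h0 h1 h2
  have e := hR.odd_pow_four_eq (hy.comp σ)
  simp only [h0, h1, h2] at e
  exact e

theorem IsRatioSystem.zero_pow_four_eq (hR : IsRatioSystem R L) (hy : IsFrame y) :
    R 0 ^ 4 = R (y 0 + y 1 + y 2 + y 3) ^ 4 := by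
  have hne : R (y 0 + y 1 + y 2 + y 3) ≠ 0 := hR.even_ne_zero _ (hy.qform_four (by decide))
  have hL : L (y 4 + y 5) ≠ 0 := hR.odd_ne_zero _ (hy.1 _ _ (by decide))
  have hl : L (y 0 + y 3) ^ 4 = L (y 4 + y 5) ^ 4 := by
    rw [hR.odd_pow_four_eq_of_nodup hy (v := 0) (x := 3) (z := 4) (by decide), add_comm (y 0),
      hR.odd_pow_four_eq_of_nodup hy (v := 4) (x := 0) (z := 5) (by decide)]
  have e1 : y 3 + y 4 + y 6 + y 7 = y 0 + y 1 + y 2 + y 5 := hy.four_compl (by decide)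
  have e2 : y 3 + y 5 + y 6 + y 7 = y 0 + y 1 + y 2 + y 4 := hy.four_compl (by decide)
  have h := congrArg (· ^ 4) (hR.edge y hy)
  simp only [mul_pow] at h
  rw [e1, e2, hR.pow_four_eq hy (i := 3) (j := 4) (k := 5) (by decide),
    hR.pow_four_eq hy (i := 1) (j := 2) (k := 5) (by decide),
    hR.pow_four_eq hy (i := 1) (j := 2) (k := 4) (by decide),
    hR.pow_four_eq hy (i := 5) (j := 6) (k := 7) (by decide),
    hR.pow_four_eq hy (i := 4) (j := 6) (k := 7) (by decide), hl] at h
  have hne4 := pow_ne_zero 4 hne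
  apply mul_right_cancel₀ (mul_ne_zero (mul_ne_zero hne4 hne4) (pow_ne_zero 4 hL))
  linear_combination -h

theorem IsRatioSystem.exists_pow_four_eq (hR : IsRatioSystem R L) :
    ∃ c, ∀ m, qform m = 0 → R m ^ 4 = c := by
  obtain ⟨y, hy⟩ := exists_isFrame
  refine ⟨R (y 0 + y 1 + y 2 + y 3) ^ 4, fun m hm => ?_⟩
  rcases hy.exists_add_eq_of_even hm with rfl | ⟨i, j, k, h, rfl⟩
  · exact hR.zero_pow_four_eq hy
  · exact hR.pow_four_eq hy h

end Combinatorics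

theorem dth_eq_sum {g : ℕ} (τ : Matrix (Fin g) (Fin g) ℂ) (m : ThetaChar g) (u : Fin g → ℂ) :
    dth τ m u = ∑ j, u j * thetaGrad (charLift m) τ j := by
  conv_lhs => rw [pi_eq_sum_univ' u]
  simp only [dth, map_sum, map_smul, smul_eq_mul]
  refine Finset.sum_congr rfl fun j _ => ?_
  congr 2

end ThetaLemmas

end

/-- Two points of the Siegel upper half-space of degree 3 with no vanishing even
theta constant and proportional odd theta gradients have proportional fourth
powers of even theta constants. -/
theorem same_bitangents_implies_same_theta_fourth
    (τ τ' : Matrix (Fin 3) (Fin 3) ℂ) (hτ : IsSiegel τ) (hτ' : IsSiegel τ')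
    (hev : ∀ m : ThetaChar 3, IsEvenChar m →
      theta (charLift m) τ 0 ≠ 0 ∧ theta (charLift m) τ' 0 ≠ 0)
    (hbit : ∀ n : ThetaChar 3, IsOddChar n → ∃ lam : ℂ, lam ≠ 0 ∧
      thetaGrad (charLift n) τ' = lam • thetaGrad (charLift n) τ) :
    ∀ m₁ m₂ : ThetaChar 3, IsEvenChar m₁ → IsEvenChar m₂ →
      theta (charLift m₁) τ 0 ^ 4 * theta (charLift m₂) τ' 0 ^ 4 =
        theta (charLift m₁) τ' 0 ^ 4 * theta (charLift m₂) τ 0 ^ 4 := by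
  intro m₁ m₂ h₁ h₂
  choose! L hL hgrad using hbit
  have hsys := ThetaLemmas.isRatioSystem_of_proportional hτ hτ'
    (fun m hm => (hev m ((ThetaLemmas.isEvenChar_iff m).2 hm)).1)
    (fun m hm => (hev m ((ThetaLemmas.isEvenChar_iff m).2 hm)).2) (L := L)
    (fun m hm => hL m ((ThetaLemmas.isOddChar_iff m).2 hm)) (fun m hm u => by
      rw [ThetaLemmas.dth_eq_sum, ThetaLemmas.dth_eq_sum,
        hgrad m ((ThetaLemmas.isOddChar_iff m).2 hm), Finset.mul_sum]
      refine Finset.sum_congr rfl fun j _ => ?_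
      rw [Pi.smul_apply, smul_eq_mul]
      ring)
  obtain ⟨c, hc⟩ := hsys.exists_pow_four_eq
  have key : ∀ m, IsEvenChar m →
      theta (charLift m) τ' 0 ^ 4 = c * theta (charLift m) τ 0 ^ 4 := fun m hm => by
    have h : (theta (charLift m) τ' 0 / theta (charLift m) τ 0) ^ 4 = c :=
      hc m ((ThetaLemmas.isEvenChar_iff m).1 hm)
    rw [div_pow, div_eq_iff (pow_ne_zero 4 (hev m hm).1)] at h
    exact h
  rw [key m₁ h₁, key m₂ h₂]
  ring
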